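/- arXiv:1809.06390 — 10 statements merged into one kernel-verified Lean document; each statement's English description precedes it below -/
import Mathlib

section
/- Let n ≥ 2 and 2 ≤ r ≤ n be integers. For a uniformly random permutation σ of {1,…,n}, the conditional probability that σ(r) = n − 1 (i.e., the object inspected at step r is the overall second best), given that σ(r) is the second largest among σ(1),…,σ(r), equals r(r−1)/(n(n−1)). -/
open scoped Classical

/-- In a finite set with at least two elements, an injective function has exactly one
second largest value. -/
theorem existsUnique_card_filter_lt_eq_one {α β : Type*} [LinearOrder β]
    {f : α → β} (hf : Function.Injective f) {s : Finset α} (hs : 2 ≤ s.card) :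
    ∃! k, k ∈ s ∧ (s.filter (fun i => f k < f i)).card = 1 := by
  obtain ⟨a, ha, hamax⟩ := s.exists_max_image f (Finset.card_pos.mp (by omega))
  have hcard := Finset.card_erase_of_mem ha
  obtain ⟨b, hb, hbmax⟩ := (s.erase a).exists_max_image f (Finset.card_pos.mp (by omega))
  obtain ⟨hba, hbs⟩ := Finset.mem_erase.mp hb
  have hlt : ∀ k l, l ∈ s → (s.filter (fun i => f k < f i)).card = 1 →
      (s.filter (fun i => f l < f i)).card = 1 → ¬ f k < f l := by
    intro k l hl hk1 hl1 hkl
    have hss : s.filter (fun i => f l < f i) ⊂ s.filter (fun i => f k < f i) := by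
      refine (Finset.ssubset_iff_of_subset ?_).mpr ⟨l, by simp [hl, hkl], by simp⟩
      intro i
      simp only [Finset.mem_filter]
      exact fun hi => ⟨hi.1, hkl.trans hi.2⟩
    have := Finset.card_lt_card hss
    omega
  have hb1 : (s.filter (fun i => f b < f i)).card = 1 := by
    refine Finset.card_eq_one.mpr ⟨a, ?_⟩
    ext i
    simp only [Finset.mem_filter, Finset.mem_singleton]
    constructor
    · rintro ⟨hi, hbi⟩
      by_contra hia
      exact absurd (hbmax i (Finset.mem_erase.mpr ⟨hia, hi⟩)) (not_le.mpr hbi)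
    · rintro rfl
      exact ⟨ha, lt_of_le_of_ne (hamax b hbs) (fun h => hba (hf h))⟩
  refine ⟨b, ⟨hbs, hb1⟩, fun k ⟨hk, hk1⟩ => ?_⟩
  exact hf (le_antisymm (not_lt.mp (hlt b k hk hb1 hk1)) (not_lt.mp (hlt k b hbs hk1 hb1)))

/-- Each element of `s` is equally likely to carry the second largest value on `s`. -/
theorem card_mul_card_perm_second_largest {α : Type*} [Fintype α] [LinearOrder α]
    {s : Finset α} (hs : 2 ≤ s.card) {j : α} (hj : j ∈ s) :
    s.card * (Finset.univ.filter (fun σ : Equiv.Perm α =>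
      (s.filter (fun i => σ j < σ i)).card = 1)).card = (Fintype.card α).factorial := by
  have hsymm : ∀ k ∈ s, (Finset.univ.filter (fun σ : Equiv.Perm α =>
      (s.filter (fun i => σ k < σ i)).card = 1)).card =
      (Finset.univ.filter (fun σ : Equiv.Perm α =>
      (s.filter (fun i => σ j < σ i)).card = 1)).card := by
    intro k hk
    refine Finset.card_equiv (Equiv.mulRight (Equiv.swap j k)) fun σ => ?_
    simp only [Finset.mem_filter, Finset.mem_univ, true_and, Equiv.coe_mulRight,
      Equiv.Perm.mul_apply, Equiv.swap_apply_left]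
    have hmem : ∀ i, Equiv.swap j k i ∈ s ↔ i ∈ s := by
      intro i
      rw [Equiv.swap_apply_def]
      split_ifs <;> simp_all
    rw [Finset.card_equiv (Equiv.swap j k) (t := s.filter fun i => σ k < σ (Equiv.swap j k i))
      (fun i => by simp [hmem])]
  rw [← smul_eq_mul, ← Finset.sum_const, ← Finset.sum_congr rfl hsymm,
    ← Fintype.card_perm, ← Finset.card_univ]
  simp only [Finset.card_filter]
  rw [Finset.sum_comm, Finset.card_eq_sum_ones]
  refine Finset.sum_congr rfl fun σ _ => ?_
  rw [← Finset.card_filter, Finset.card_eq_one]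
  obtain ⟨k, hk, huniq⟩ := existsUnique_card_filter_lt_eq_one σ.injective hs
  exact ⟨k, Finset.ext fun i => by
    simpa only [Finset.mem_filter, Finset.mem_singleton, ← Finset.card_filter] using
      ⟨fun h => huniq i h, fun h => h ▸ hk⟩⟩

/-- The permutations with two prescribed values, counted. -/
theorem card_mul_card_perm_apply_eq_apply_eq {α : Type*} [Fintype α] [DecidableEq α]
    {a b i j : α} (hab : a ≠ b) (hij : i ≠ j) :
    Fintype.card α * (Fintype.card α - 1) * (Finset.univ.filter (fun σ : Equiv.Perm α =>
      σ i = a ∧ σ j = b)).card = (Fintype.card α).factorial := by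
  have hmaps : Set.MapsTo (fun σ : Equiv.Perm α => (σ i, σ j))
      (Finset.univ : Finset (Equiv.Perm α)) ((Finset.univ : Finset α).offDiag) := by
    intro σ _
    simpa using hij
  have hfib : ∀ p ∈ (Finset.univ : Finset α).offDiag,
      (Finset.univ.filter (fun σ : Equiv.Perm α => (σ i, σ j) = p)).card =
      (Finset.univ.filter (fun σ : Equiv.Perm α => σ i = a ∧ σ j = b)).card := by
    rintro ⟨c, d⟩ hcd
    have hcd : c ≠ d := by simpa using hcd
    obtain ⟨τ, hc, hd⟩ := MulAction.is_two_pretransitive_iff.mp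
      (Equiv.Perm.isMultiplyPretransitive α 2) hcd hab
    refine Finset.card_equiv (Equiv.mulLeft τ) fun σ => ?_
    simp only [Equiv.Perm.smul_def] at hc hd
    simp [← hc, ← hd]
  have := Finset.card_eq_sum_card_fiberwise hmaps
  rw [Finset.sum_congr rfl hfib, Finset.sum_const, Finset.card_univ, Fintype.card_perm,
    Finset.offDiag_card, Finset.card_univ, smul_eq_mul] at this
  rw [this, Nat.mul_sub_one]

/-- The position `j` carries the second best value and is second best among the first positions
exactly when the best value appears before `j`. -/
theorem card_perm_second_largest_eq_second {n : ℕ} {j second last : Fin n}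
    (hlast : ∀ x, second < x ↔ x = last) :
    (Finset.univ.filter (fun σ : Equiv.Perm (Fin n) =>
      ((Finset.Iic j).filter (fun i => σ j < σ i)).card = 1 ∧ σ j = second)).card =
    ∑ i ∈ Finset.Iio j, (Finset.univ.filter (fun σ : Equiv.Perm (Fin n) =>
      σ i = last ∧ σ j = second)).card := by
  have hne : second < last := (hlast last).mpr rfl
  rw [← Finset.card_biUnion]
  · congr 1
    ext σ
    simp only [Finset.mem_filter, Finset.mem_univ, true_and, Finset.mem_biUnion, Finset.mem_Iio]
    constructor
    · rintro ⟨h, rfl⟩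
      obtain ⟨i, hi⟩ := Finset.card_eq_one.mp h
      have hmem : i ∈ (Finset.Iic j).filter (fun i => σ j < σ i) := by simp [hi]
      simp only [Finset.mem_filter, Finset.mem_Iic, hlast] at hmem
      refine ⟨i, lt_of_le_of_ne hmem.1 ?_, hmem.2, rfl⟩
      rintro rfl
      exact hne.ne hmem.2
    · rintro ⟨i, hi, hil, rfl⟩
      refine ⟨Finset.card_eq_one.mpr ⟨i, ?_⟩, rfl⟩
      ext k
      simp only [Finset.mem_filter, Finset.mem_Iic, hlast, Finset.mem_singleton, ← hil,
        σ.injective.eq_iff]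
      exact ⟨fun h => h.2, fun h => ⟨h ▸ hi.le, h⟩⟩
  · intro i _ k _ hik
    refine Finset.disjoint_left.mpr fun σ hσ hσ' => hik ?_
    simp only [Finset.mem_filter, Finset.mem_univ, true_and] at hσ hσ'
    exact σ.injective (hσ.1.trans hσ'.1.symm)

/-- Model the Postdoc problem by a uniformly random permutation
`σ` of `{1,…,n}` (here `Fin n`, value `0` = worst rank, value `n-1` = best rank,
so `n-2` is the overall second best).  For `2 ≤ r ≤ n`, the conditional probability
that the object inspected at step `r` is the overall second best, given that it is
the second largest among the first `r` inspected values (exactly one earlier value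
is larger), equals `r(r-1)/(n(n-1))`.  Conditional probability is the ratio of the
number of permutations in both events to the number in the conditioning event. -/
theorem stmt_1 (n r : ℕ) (hn : 2 ≤ n) (hr1 : 2 ≤ r) (hrn : r ≤ n)
    (j second : Fin n) (hj : (j : ℕ) = r - 1) (hsecond : (second : ℕ) = n - 2) :
    ((Finset.univ.filter (fun σ : Equiv.Perm (Fin n) =>
        ((Finset.Iic j).filter (fun i => σ j < σ i)).card = 1 ∧ σ j = second)).card : ℚ) /
      ((Finset.univ.filter (fun σ : Equiv.Perm (Fin n) =>
        ((Finset.Iic j).filter (fun i => σ j < σ i)).card = 1)).card : ℚ)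
      = ((r : ℚ) * ((r : ℚ) - 1)) / ((n : ℚ) * ((n : ℚ) - 1)) := by
  obtain ⟨m, rfl⟩ : ∃ m, n = m + 2 := ⟨n - 2, by omega⟩
  obtain ⟨q, rfl⟩ : ∃ q, r = q + 1 := ⟨r - 1, by omega⟩
  have hjq : (j : ℕ) = q := by omega
  have hlast : ∀ x, second < x ↔ x = Fin.last (m + 1) := by
    intro x
    rw [Fin.lt_def, Fin.ext_iff, Fin.val_last]
    omega
  have hne : Fin.last (m + 1) ≠ second := ((hlast _).mpr rfl).ne'
  have hden := card_mul_card_perm_second_largest (s := Finset.Iic j) (j := j)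
    (by rw [Fin.card_Iic]; omega) (by simp)
  have hnum : (m + 2) * (m + 1) * (Finset.univ.filter (fun σ : Equiv.Perm (Fin (m + 2)) =>
      ((Finset.Iic j).filter (fun i => σ j < σ i)).card = 1 ∧ σ j = second)).card =
      q * (m + 2).factorial := by
    rw [card_perm_second_largest_eq_second hlast, Finset.mul_sum,
      Finset.sum_congr rfl (g := fun _ => (m + 2).factorial), Finset.sum_const, Fin.card_Iio,
      hjq, smul_eq_mul]
    intro i hi
    have h := card_mul_card_perm_apply_eq_apply_eq hne (Finset.mem_Iio.mp hi).ne
    rwa [Fintype.card_fin, show m + 2 - 1 = m + 1 by omega] at h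
  rw [Fin.card_Iic, Fintype.card_fin, hjq] at hden
  rw [← hden] at hnum
  have hpos : 0 < (m + 2).factorial := Nat.factorial_pos _
  rw [← hden] at hpos
  have hden0 := Nat.pos_of_mul_pos_left hpos
  have hnumQ := congrArg (Nat.cast : ℕ → ℚ) hnum
  push_cast at hnumQ ⊢
  have hm : (0 : ℚ) < ((m : ℚ) + 2) * ((m : ℚ) + 2 - 1) := by
    have : (0 : ℚ) ≤ m := Nat.cast_nonneg m
    exact mul_pos (by linarith) (by linarith)
  rw [div_eq_div_iff (by exact_mod_cast hden0.ne') hm.ne']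
  linear_combination hnumQ
end

section
/- Let n ≥ 2 be an integer. For a uniformly random permutation σ of {1,…,n}, the probability that the threshold strategy with cutoff r succeeds in the Best-or-Worst problem equals 2/n when r = 0, equals 2r(n−r)/(n(n−1)) when 1 ≤ r ≤ n, and the strategy never succeeds (probability 0) when r ≥ n. -/
open scoped Classical

/-- Position `j` is a BW-record: `σ j` is a maximum or a minimum of the values
inspected so far. -/
def bwRecord {n : ℕ} (σ : Equiv.Perm (Fin n)) (j : Fin n) : Prop :=
  (∀ i ≤ j, σ i ≤ σ j) ∨ (∀ i ≤ j, σ j ≤ σ i)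

/-- The threshold strategy with cutoff `r` succeeds in the Best-or-Worst problem:
the first BW-record position `j` of 1-based position `> r` (i.e. with `r ≤ (j:ℕ)`)
exists and carries the overall best or the overall worst object
(value `n-1` = best, value `0` = worst). -/
def bwSuccess (n r : ℕ) (σ : Equiv.Perm (Fin n)) : Prop :=
  ∃ j : Fin n, r ≤ (j : ℕ) ∧ bwRecord σ j ∧
    (∀ i : Fin n, r ≤ (i : ℕ) → i < j → ¬ bwRecord σ i) ∧
    ((σ j : ℕ) = 0 ∨ (σ j : ℕ) = n - 1)

/-- The permutation of `Fin (n + 1)` whose last value is `v` and whose other values are ordered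
as those of `τ`. -/
noncomputable def permSnoc {n : ℕ} (v : Fin (n + 1)) (τ : Equiv.Perm (Fin n)) :
    Equiv.Perm (Fin (n + 1)) :=
  (finSuccEquiv' (Fin.last n)).trans ((Equiv.optionCongr τ).trans (finSuccEquiv' v).symm)

@[simp]
lemma permSnoc_last {n : ℕ} (v : Fin (n + 1)) (τ : Equiv.Perm (Fin n)) :
    permSnoc v τ (Fin.last n) = v := by
  simp [permSnoc]

@[simp]
lemma permSnoc_castSucc {n : ℕ} (v : Fin (n + 1)) (τ : Equiv.Perm (Fin n)) (i : Fin n) :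
    permSnoc v τ i.castSucc = v.succAbove (τ i) := by
  rw [← Fin.succAbove_last_apply]
  simp [permSnoc, -Fin.succAbove_last]

lemma permSnoc_bijective (n : ℕ) :
    Function.Bijective (fun p : Fin (n + 1) × Equiv.Perm (Fin n) => permSnoc p.1 p.2) := by
  rw [Fintype.bijective_iff_injective_and_card]
  refine ⟨?_, by simp [Fintype.card_perm, Nat.factorial_succ]⟩
  rintro ⟨v, τ⟩ ⟨w, ρ⟩ h
  obtain rfl : v = w := by simpa using Equiv.congr_fun h (Fin.last n)
  refine Prod.ext rfl (Equiv.ext fun i => ?_)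
  simpa using Equiv.congr_fun h i.castSucc

lemma card_filter_perm_succ {n : ℕ} (P : Equiv.Perm (Fin (n + 1)) → Prop) :
    (Finset.univ.filter P).card =
      ∑ v : Fin (n + 1),
        (Finset.univ.filter fun τ : Equiv.Perm (Fin n) => P (permSnoc v τ)).card := by
  simp only [Finset.card_filter]
  rw [← Fintype.sum_prod_type' fun v τ => if P (permSnoc v τ) then 1 else 0]
  exact ((permSnoc_bijective n).sum_comp fun σ => if P σ then 1 else 0).symm

lemma sum_fin_eq_ends_add_middle {m : ℕ} (f : Fin (m + 2) → ℕ) (c : ℕ)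
    (hf : ∀ v, v ≠ 0 → v ≠ Fin.last (m + 1) → f v = c) :
    ∑ v, f v = f 0 + m * c + f (Fin.last (m + 1)) := by
  rw [Fin.sum_univ_succ, Fin.sum_univ_castSucc, Finset.sum_congr rfl fun i _ =>
    hf i.castSucc.succ (Fin.succ_ne_zero _) (by
      rw [← Fin.succ_last]
      exact fun h => (Fin.castSucc_lt_last i).ne (Fin.succ_injective _ h))]
  simp [add_assoc]

lemma bwRecord_permSnoc_castSucc {n : ℕ} (v : Fin (n + 1)) (τ : Equiv.Perm (Fin n)) (i : Fin n) :
    bwRecord (permSnoc v τ) i.castSucc ↔ bwRecord τ i := by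
  have key : ∀ p : Fin (n + 1) → Prop,
      (∀ k ≤ i.castSucc, p k) ↔ ∀ k ≤ i, p k.castSucc := fun p => by
    simp [Fin.forall_fin_succ', (Fin.castSucc_lt_last i).not_ge]
  simp [bwRecord, key]

lemma bwRecord_permSnoc_last {n : ℕ} (v : Fin (n + 1)) (τ : Equiv.Perm (Fin n)) :
    bwRecord (permSnoc v τ) (Fin.last n) ↔ v = 0 ∨ v = Fin.last n := by
  simp only [bwRecord, Fin.le_last, true_imp_iff, permSnoc_last]
  rw [(permSnoc v τ).forall_congr_left (p := fun i => permSnoc v τ i ≤ v),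
    (permSnoc v τ).forall_congr_left (p := fun i => v ≤ permSnoc v τ i)]
  simp only [Equiv.apply_symm_apply]
  rw [or_comm]
  refine or_congr ⟨fun h => Fin.le_zero_iff.1 (h 0), ?_⟩ ⟨fun h => Fin.last_le_iff.1 (h _), ?_⟩
  · rintro rfl w
    exact Fin.zero_le w
  · rintro rfl w
    exact Fin.le_last w

/-- No position from `r` on is a BW-record. -/
def noBWRecordFrom {n : ℕ} (r : ℕ) (σ : Equiv.Perm (Fin n)) : Prop :=
  ∀ i : Fin n, r ≤ (i : ℕ) → ¬ bwRecord σ i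

/-- The first BW-record from position `r` on exists and carries the value `c`. -/
def firstBWRecordHits {n : ℕ} (r : ℕ) (σ : Equiv.Perm (Fin n)) (c : Fin n) : Prop :=
  ∃ j : Fin n, r ≤ (j : ℕ) ∧ bwRecord σ j ∧
    (∀ i : Fin n, r ≤ (i : ℕ) → i < j → ¬ bwRecord σ i) ∧ σ j = c

lemma bwSuccess_iff {m r : ℕ} (σ : Equiv.Perm (Fin (m + 1))) :
    bwSuccess (m + 1) r σ ↔
      firstBWRecordHits r σ 0 ∨ firstBWRecordHits r σ (Fin.last m) := by
  simp only [bwSuccess, firstBWRecordHits, ← exists_or, ← and_or_left, Fin.ext_iff]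
  rfl

lemma firstBWRecordHits.eq {n r : ℕ} {σ : Equiv.Perm (Fin n)} {c d : Fin n}
    (hc : firstBWRecordHits r σ c) (hd : firstBWRecordHits r σ d) : c = d := by
  obtain ⟨j, hj, hjr, hjf, rfl⟩ := hc
  obtain ⟨k, hk, hkr, hkf, rfl⟩ := hd
  rcases lt_trichotomy j k with h | h | h
  · exact absurd hjr (hkf j hj h)
  · rw [h]
  · exact absurd hkr (hjf k hk h)

lemma firstBWRecordHits.not_noBWRecordFrom {n r : ℕ} {σ : Equiv.Perm (Fin n)} {c : Fin n}
    (hc : firstBWRecordHits r σ c) : ¬ noBWRecordFrom r σ := by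
  obtain ⟨j, hj, hjr, -⟩ := hc
  exact fun h => h j hj hjr

lemma noBWRecordFrom_permSnoc {n r : ℕ} (hr : r ≤ n) (v : Fin (n + 1))
    (τ : Equiv.Perm (Fin n)) :
    noBWRecordFrom r (permSnoc v τ) ↔ noBWRecordFrom r τ ∧ ¬ (v = 0 ∨ v = Fin.last n) := by
  simp only [noBWRecordFrom, Fin.forall_fin_succ', bwRecord_permSnoc_castSucc,
    bwRecord_permSnoc_last, Fin.val_castSucc, Fin.val_last, hr, true_imp_iff]

lemma firstBWRecordHits_permSnoc {n r : ℕ} (hr : r ≤ n) (v c : Fin (n + 1))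
    (τ : Equiv.Perm (Fin n)) :
    firstBWRecordHits r (permSnoc v τ) c ↔
      (∃ d, firstBWRecordHits r τ d ∧ v.succAbove d = c) ∨
        ((v = 0 ∨ v = Fin.last n) ∧ noBWRecordFrom r τ ∧ v = c) := by
  have hlt (i : Fin n) : ¬ Fin.last n < i.castSucc := (Fin.castSucc_lt_last i).not_gt
  simp only [firstBWRecordHits, noBWRecordFrom, Fin.exists_fin_succ', Fin.forall_fin_succ',
    bwRecord_permSnoc_castSucc, bwRecord_permSnoc_last, Fin.val_castSucc, Fin.val_last, hr,
    permSnoc_castSucc, permSnoc_last, Fin.castSucc_lt_castSucc_iff, Fin.castSucc_lt_last, hlt,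
    lt_irrefl, true_imp_iff, false_imp_iff, and_true, true_and]
  refine or_congr ⟨?_, ?_⟩ Iff.rfl
  · rintro ⟨j, h1, h2, h3, h4⟩
    exact ⟨τ j, ⟨j, h1, h2, h3, rfl⟩, h4⟩
  · rintro ⟨_, ⟨j, h1, h2, h3, rfl⟩, h4⟩
    exact ⟨j, h1, h2, h3, h4⟩

lemma bwSuccess_permSnoc_zero {m r : ℕ} (hr : r ≤ m + 1) (τ : Equiv.Perm (Fin (m + 1))) :
    bwSuccess (m + 2) r (permSnoc 0 τ) ↔
      firstBWRecordHits r τ (Fin.last m) ∨ noBWRecordFrom r τ := by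
  rw [bwSuccess_iff, firstBWRecordHits_permSnoc hr, firstBWRecordHits_permSnoc hr,
    ← Fin.succ_last]
  simp [Fin.succ_ne_zero, or_comm]

lemma bwSuccess_permSnoc_last {m r : ℕ} (hr : r ≤ m + 1) (τ : Equiv.Perm (Fin (m + 1))) :
    bwSuccess (m + 2) r (permSnoc (Fin.last (m + 1)) τ) ↔
      firstBWRecordHits r τ 0 ∨ noBWRecordFrom r τ := by
  rw [bwSuccess_iff, firstBWRecordHits_permSnoc hr, firstBWRecordHits_permSnoc hr]
  simp [Fin.castSucc_ne_last]

lemma bwSuccess_permSnoc_middle {m r : ℕ} (hr : r ≤ m + 1) (τ : Equiv.Perm (Fin (m + 1)))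
    {v : Fin (m + 2)} (h0 : v ≠ 0) (hl : v ≠ Fin.last (m + 1)) :
    bwSuccess (m + 2) r (permSnoc v τ) ↔ bwSuccess (m + 1) r τ := by
  rw [bwSuccess_iff, bwSuccess_iff, firstBWRecordHits_permSnoc hr, firstBWRecordHits_permSnoc hr]
  simp [h0, hl, Fin.succAbove_eq_zero_iff h0, Fin.succAbove_eq_last_iff hl]

lemma card_noBWRecordFrom_succ {m r : ℕ} (hr : r ≤ m + 1) :
    (Finset.univ.filter (noBWRecordFrom (n := m + 2) r)).card =
      m * (Finset.univ.filter (noBWRecordFrom (n := m + 1) r)).card := by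
  rw [card_filter_perm_succ, sum_fin_eq_ends_add_middle _
    (Finset.univ.filter (noBWRecordFrom (n := m + 1) r)).card]
  · simp [noBWRecordFrom_permSnoc hr]
  · intro v h0 hl
    simp [noBWRecordFrom_permSnoc hr, h0, hl]

lemma card_bwSuccess_succ {m r : ℕ} (hr : r ≤ m + 1) (hmr : 1 ≤ m ∨ 1 ≤ r) :
    (Finset.univ.filter (bwSuccess (m + 2) r)).card =
      (m + 1) * (Finset.univ.filter (bwSuccess (m + 1) r)).card +
        2 * (Finset.univ.filter (noBWRecordFrom (n := m + 1) r)).card := by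
  have hdisj (c : Fin (m + 1)) : Disjoint
      (Finset.univ.filter fun τ : Equiv.Perm (Fin (m + 1)) => firstBWRecordHits r τ c)
      (Finset.univ.filter (noBWRecordFrom r)) :=
    Finset.disjoint_filter.2 fun _ _ h => h.not_noBWRecordFrom
  have hends : Disjoint
      (Finset.univ.filter fun τ : Equiv.Perm (Fin (m + 1)) => firstBWRecordHits r τ 0)
      (Finset.univ.filter fun τ => firstBWRecordHits r τ (Fin.last m)) := by
    refine Finset.disjoint_filter.2 fun τ _ h h' => ?_
    have hm : 0 = m := congrArg Fin.val (h.eq h')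
    obtain ⟨j, hj, -⟩ := h
    omega
  have hsum : (Finset.univ.filter (bwSuccess (m + 1) r)).card =
      (Finset.univ.filter fun τ : Equiv.Perm (Fin (m + 1)) => firstBWRecordHits r τ 0).card +
      (Finset.univ.filter fun τ : Equiv.Perm (Fin (m + 1)) =>
        firstBWRecordHits r τ (Fin.last m)).card := by
    rw [← Finset.card_union_of_disjoint hends, ← Finset.filter_or]
    simp only [bwSuccess_iff]
  rw [card_filter_perm_succ, sum_fin_eq_ends_add_middle _
    (Finset.univ.filter (bwSuccess (m + 1) r)).card]
  · simp only [bwSuccess_permSnoc_zero hr, bwSuccess_permSnoc_last hr, Finset.filter_or]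
    rw [Finset.card_union_of_disjoint (hdisj _), Finset.card_union_of_disjoint (hdisj _), hsum]
    ring
  · intro v h0 hl
    simp only [bwSuccess_permSnoc_middle hr _ h0 hl]

lemma card_bwSuccess_of_le {n r : ℕ} (h : n ≤ r) :
    (Finset.univ.filter (bwSuccess n r)).card = 0 := by
  rw [Finset.card_eq_zero, Finset.filter_eq_empty_iff]
  rintro σ - ⟨j, hj, -⟩
  omega

lemma card_noBWRecordFrom_of_le {n r : ℕ} (h : n ≤ r) :
    (Finset.univ.filter (noBWRecordFrom (n := n) r)).card = n.factorial := by
  rw [Finset.filter_true_of_mem, Finset.card_univ, Fintype.card_perm, Fintype.card_fin]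
  intro σ _ i hi
  omega

lemma card_noBWRecordFrom_mul {n r : ℕ} (hr : 1 ≤ r) (h : r ≤ n) :
    (Finset.univ.filter (noBWRecordFrom (n := n) r)).card * ((n : ℚ) * (n - 1)) =
      r * (r - 1) * n.factorial := by
  induction n, h using Nat.le_induction with
  | base => rw [card_noBWRecordFrom_of_le le_rfl]; ring
  | succ n hn ih =>
    obtain ⟨m, rfl⟩ : ∃ m, n = m + 1 := ⟨n - 1, by omega⟩
    rw [card_noBWRecordFrom_succ hn, Nat.factorial_succ (m + 1)]
    push_cast at ih ⊢
    linear_combination ((m : ℚ) + 2) * ih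

lemma card_bwSuccess_mul {n r : ℕ} (hr : 1 ≤ r) (h : r ≤ n) :
    (Finset.univ.filter (bwSuccess n r)).card * ((n : ℚ) * (n - 1)) =
      2 * r * (n - r) * n.factorial := by
  induction n, h using Nat.le_induction with
  | base => rw [card_bwSuccess_of_le le_rfl]; simp
  | succ n hn ih =>
    obtain ⟨m, rfl⟩ : ∃ m, n = m + 1 := ⟨n - 1, by omega⟩
    have hN := card_noBWRecordFrom_mul hr hn
    rw [card_bwSuccess_succ hn (Or.inr hr), Nat.factorial_succ (m + 1)]
    rcases Nat.eq_zero_or_pos m with rfl | hm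
    · obtain rfl : r = 1 := by omega
      rw [card_bwSuccess_of_le (by omega), card_noBWRecordFrom_of_le (by omega)]
      norm_num
    · have hm' : (m : ℚ) ≠ 0 := by positivity
      push_cast at ih hN ⊢
      refine mul_left_cancel₀ hm' ?_
      linear_combination ((m : ℚ) + 2) * (m + 1) * ih + 2 * ((m : ℚ) + 2) * hN

lemma noBWRecordFrom_zero {m : ℕ} (σ : Equiv.Perm (Fin (m + 1))) : ¬ noBWRecordFrom 0 σ :=
  fun h => h 0 (Nat.zero_le _) (Or.inl fun i hi => by rw [Fin.le_zero_iff.1 hi])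

lemma card_bwSuccess_zero (m : ℕ) :
    (Finset.univ.filter (bwSuccess (m + 2) 0)).card = 2 * (m + 1).factorial := by
  induction m with
  | zero =>
    rw [Finset.filter_true_of_mem]
    · simp [Fintype.card_perm]
    · intro σ _
      refine ⟨0, Nat.zero_le _, Or.inl fun i hi => by rw [Fin.le_zero_iff.1 hi],
        fun i _ hi => absurd hi (Fin.not_lt_zero i), ?_⟩
      have := (σ 0).isLt
      omega
  | succ m ih =>
    rw [card_bwSuccess_succ (by omega) (Or.inl (by omega)), ih,
      Finset.filter_false_of_mem fun σ _ => noBWRecordFrom_zero σ, Nat.factorial_succ (m + 1)]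
    simp only [Finset.card_empty]
    ring

/-- For a uniformly random permutation of `{1,…,n}` (`n ≥ 2`), the
probability that the threshold strategy with cutoff `r` succeeds in the
Best-or-Worst problem equals `2/n` when `r = 0`, equals `2r(n-r)/(n(n-1))` when
`1 ≤ r ≤ n`, and equals `0` when `r ≥ n`. -/
theorem stmt_2 (n : ℕ) (hn : 2 ≤ n) (r : ℕ) :
    (r = 0 →
      ((Finset.univ.filter (bwSuccess n r)).card : ℚ) / (Nat.factorial n : ℚ)
        = 2 / (n : ℚ)) ∧
    (1 ≤ r → r ≤ n →
      ((Finset.univ.filter (bwSuccess n r)).card : ℚ) / (Nat.factorial n : ℚ)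
        = 2 * (r : ℚ) * ((n : ℚ) - (r : ℚ)) / ((n : ℚ) * ((n : ℚ) - 1))) ∧
    (n ≤ r →
      ((Finset.univ.filter (bwSuccess n r)).card : ℚ) / (Nat.factorial n : ℚ) = 0) := by
  have hn0 : (n : ℚ) ≠ 0 := by positivity
  have hf : (n.factorial : ℚ) ≠ 0 := by positivity
  refine ⟨?_, fun hr hrn => ?_, fun h => by simp [card_bwSuccess_of_le h]⟩
  · rintro rfl
    obtain ⟨m, rfl⟩ : ∃ m, n = m + 2 := ⟨n - 2, by omega⟩
    rw [card_bwSuccess_zero, div_eq_div_iff hf hn0, Nat.factorial_succ (m + 1)]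
    push_cast
    ring
  · have hn1 : (n : ℚ) - 1 ≠ 0 := by
      have : (2 : ℚ) ≤ n := by exact_mod_cast hn
      linarith
    rw [div_eq_div_iff hf (mul_ne_zero hn0 hn1)]
    exact card_bwSuccess_mul hr hrn
end

section
/- Let n ≥ 2 be an integer. For a uniformly random permutation σ of {1,…,n}, the threshold strategy with cutoff ⌊n/2⌋ maximizes, over all cutoffs r ∈ {0, 1, …, n}, the probability of success in the Best-or-Worst problem, and its success probability equals n/(2(n−1)) if n is even and (n+1)/(2n) if n is odd. -/
open scoped Classical

open Equiv Finset

/-- Double counting over the transpositions `swap k r` with `k ∈ T`. -/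
theorem card_mul_card_filter_swap {n : ℕ} (T : Finset (Fin n)) (r : Fin n) (c : ℕ)
    (P : Perm (Fin n) → Prop) (G : Perm (Fin n) → Fin n → Prop)
    (hP : ∀ σ, ∀ k ∈ T, P (σ * swap k r) ↔ P σ)
    (hG : ∀ σ, ∀ k ∈ T, G (σ * swap k r) r ↔ G σ k)
    (hc : ∀ σ, #{k ∈ T | G σ k} = c) :
    #T * #{σ | P σ ∧ G σ r} = c * #{σ | P σ} := by
  have hcard : ∀ k ∈ T, #{σ | P σ ∧ G σ r} = #{σ | P σ ∧ G σ k} := by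
    intro k hk
    refine Finset.card_equiv (Equiv.mulRight (swap k r)) fun σ => ?_
    have hσ : σ * swap k r * swap k r = σ := by simp [mul_assoc]
    have h := hG (σ * swap k r) k hk
    rw [hσ] at h
    simp [hP σ k hk, h]
  calc #T * #{σ | P σ ∧ G σ r} = ∑ k ∈ T, #{σ | P σ ∧ G σ k} := by
        rw [← smul_eq_mul, ← Finset.sum_const, Finset.sum_congr rfl hcard]
    _ = ∑ k ∈ T, ∑ σ ∈ {σ | P σ}, if G σ k then 1 else 0 := by
        simp only [← Finset.card_filter, Finset.filter_filter]
    _ = ∑ σ ∈ {σ | P σ}, #{k ∈ T | G σ k} := by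
        rw [Finset.sum_comm]
        simp only [← Finset.card_filter]
    _ = c * #{σ | P σ} := by simp [hc, mul_comm]

theorem swap_le_of_le {n : ℕ} {k r i j : Fin n} (hk : k ≤ j) (hr : r ≤ j) (hi : i ≤ j) :
    swap k r i ≤ j := by
  rw [swap_apply_def]
  split_ifs <;> assumption

theorem forall_le_swap_iff {n : ℕ} {k r j : Fin n} (hk : k ≤ j) (hr : r ≤ j)
    (Q : Fin n → Prop) : (∀ i ≤ j, Q (swap k r i)) ↔ ∀ i ≤ j, Q i := by
  refine ⟨fun h i hi => ?_, fun h i hi => h _ (swap_le_of_le hk hr hi)⟩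
  simpa using h _ (swap_le_of_le hk hr hi)

theorem bwRecord_mul_swap {n : ℕ} (σ : Perm (Fin n)) {k r j : Fin n} (hk : k ≤ r) (hr : r < j) :
    bwRecord (σ * swap k r) j ↔ bwRecord σ j := by
  have hj : swap k r j = j := swap_apply_of_ne_of_ne (hk.trans_lt hr).ne' hr.ne'
  simp only [bwRecord, Perm.mul_apply, hj]
  rw [forall_le_swap_iff (hk.trans hr.le) hr.le (fun i => σ i ≤ σ j),
    forall_le_swap_iff (hk.trans hr.le) hr.le (fun i => σ j ≤ σ i)]

theorem bwSuccess_mul_swap {n : ℕ} (σ : Perm (Fin n)) {k r : Fin n} (hk : k ≤ r) :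
    bwSuccess n (r + 1) (σ * swap k r) ↔ bwSuccess n (r + 1) σ := by
  refine exists_congr fun j => and_congr_right fun hj => ?_
  have hj' : r < j := hj
  have hσ : swap k r j = j := swap_apply_of_ne_of_ne (hk.trans_lt hj').ne' hj'.ne'
  rw [bwRecord_mul_swap σ hk hj', Perm.mul_apply, hσ]
  refine and_congr_right fun _ => and_congr_left fun _ => ?_
  refine forall_congr' fun i => imp_congr_right fun hi => ?_
  rw [bwRecord_mul_swap σ hk hi]

theorem bwRecord_of_extreme {n : ℕ} (σ : Perm (Fin n)) (j : Fin n)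
    (h : (σ j : ℕ) = 0 ∨ (σ j : ℕ) = n - 1) : bwRecord σ j := by
  rcases h with h | h
  · exact Or.inr fun i _ => by rw [Fin.le_def]; omega
  · exact Or.inl fun i _ => by rw [Fin.le_def]; omega

theorem bwSuccess_iff_s4 {n : ℕ} (σ : Perm (Fin n)) (r : Fin n) :
    bwSuccess n r σ ↔ ((σ r : ℕ) = 0 ∨ (σ r : ℕ) = n - 1) ∨
      (bwSuccess n (r + 1) σ ∧ ¬ bwRecord σ r) := by
  constructor
  · rintro ⟨j, hrj, hrec, hfirst, hext⟩
    rcases (Fin.le_def.mpr hrj).eq_or_lt with rfl | hlt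
    · exact Or.inl hext
    · exact Or.inr ⟨⟨j, hlt, hrec, fun i hi => hfirst i (by omega), hext⟩, hfirst r le_rfl hlt⟩
  · rintro (h | ⟨⟨j, hrj, hrec, hfirst, hext⟩, hr⟩)
    · refine ⟨r, le_rfl, bwRecord_of_extreme σ r h, fun i hi hlt => ?_, h⟩
      exact absurd (Fin.le_def.mpr hi) hlt.not_ge
    · refine ⟨j, by omega, hrec, fun i hi hlt => ?_, hext⟩
      rcases (Fin.le_def.mpr hi).eq_or_lt with rfl | hri
      · exact hr
      · exact hfirst i hri hlt

theorem card_bwSuccess_add {n : ℕ} (r : Fin n) :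
    #{σ | bwSuccess n r σ} + #{σ | bwSuccess n (r + 1) σ ∧ bwRecord σ r} =
      #{σ : Perm (Fin n) | (σ r : ℕ) = 0 ∨ (σ r : ℕ) = n - 1} +
        #{σ | bwSuccess n (r + 1) σ} := by
  have hsplit : #{σ | bwSuccess n r σ} =
      #{σ : Perm (Fin n) | (σ r : ℕ) = 0 ∨ (σ r : ℕ) = n - 1} +
        #{σ | bwSuccess n (r + 1) σ ∧ ¬ bwRecord σ r} := by
    rw [← Finset.card_union_of_disjoint, ← Finset.filter_or]
    · simp only [bwSuccess_iff_s4]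
    · rw [Finset.disjoint_filter]
      exact fun σ _ h h' => h'.2 (bwRecord_of_extreme σ r h)
  have h := Finset.card_filter_add_card_filter_not (s := {σ | bwSuccess n (r + 1) σ})
    (fun σ => bwRecord σ r)
  simp only [Finset.filter_filter] at h
  omega

theorem card_extreme {n : ℕ} (hn : 2 ≤ n) (r : Fin n) :
    n * #{σ : Perm (Fin n) | (σ r : ℕ) = 0 ∨ (σ r : ℕ) = n - 1} = 2 * n.factorial := by
  have h := card_mul_card_filter_swap univ r 2 (fun _ => True)
    (fun σ k => (σ k : ℕ) = 0 ∨ (σ k : ℕ) = n - 1) (by simp) (by simp) fun σ => by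
      rw [Finset.card_eq_two]
      refine ⟨σ.symm ⟨0, by omega⟩, σ.symm ⟨n - 1, by omega⟩, ?_, ?_⟩
      · rw [Ne, σ.symm.injective.eq_iff, Fin.mk.injEq]
        omega
      · ext k
        simp [Equiv.eq_symm_apply, Fin.ext_iff]
  simpa [Fintype.card_perm] using h

theorem card_prefix_extreme {n : ℕ} (σ : Perm (Fin n)) (r : Fin n) (hr : 1 ≤ (r : ℕ)) :
    #{k ∈ Iic r | (∀ i ≤ r, σ i ≤ σ k) ∨ (∀ i ≤ r, σ k ≤ σ i)} = 2 := by
  obtain ⟨a, ha, hmax⟩ := Finset.exists_max_image (Iic r) σ ⟨r, by simp⟩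
  obtain ⟨b, hb, hmin⟩ := Finset.exists_min_image (Iic r) σ ⟨r, by simp⟩
  simp only [Finset.mem_Iic] at ha hb hmax hmin
  rw [Finset.card_eq_two]
  refine ⟨a, b, ?_, ?_⟩
  · rintro rfl
    have hconst : ∀ i ≤ r, i = a := fun i hi =>
      σ.injective (le_antisymm (hmax i hi) (hmin i hi))
    have h0 := (hconst ⟨0, by omega⟩ (by simp [Fin.le_def])).trans (hconst r le_rfl).symm
    rw [Fin.ext_iff] at h0
    simp only at h0
    omega
  · ext k
    simp only [Finset.mem_filter, Finset.mem_Iic, Finset.mem_insert, Finset.mem_singleton]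
    constructor
    · rintro ⟨hk, h | h⟩
      · exact Or.inl (σ.injective (le_antisymm (hmax k hk) (h a ha)))
      · exact Or.inr (σ.injective (le_antisymm (h b hb) (hmin k hk)))
    · rintro (rfl | rfl)
      · exact ⟨ha, Or.inl hmax⟩
      · exact ⟨hb, Or.inr hmin⟩

theorem card_bwSuccess_and_bwRecord {n : ℕ} (r : Fin n) (hr : 1 ≤ (r : ℕ)) :
    (r + 1) * #{σ | bwSuccess n (r + 1) σ ∧ bwRecord σ r} =
      2 * #{σ | bwSuccess n (r + 1) σ} := by
  have h := card_mul_card_filter_swap (Iic r) r 2 (bwSuccess n (r + 1))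
    (fun σ k => (∀ i ≤ r, σ i ≤ σ k) ∨ (∀ i ≤ r, σ k ≤ σ i))
    (fun σ k hk => bwSuccess_mul_swap σ (Finset.mem_Iic.mp hk))
    (fun σ k hk => by
      simp only [Perm.mul_apply, swap_apply_right]
      rw [forall_le_swap_iff (Finset.mem_Iic.mp hk) le_rfl (fun i => σ i ≤ σ k),
        forall_le_swap_iff (Finset.mem_Iic.mp hk) le_rfl (fun i => σ k ≤ σ i)])
    (fun σ => by convert card_prefix_extreme σ r hr)
  rwa [Fin.card_Iic] at h

/-- The success probability of the cutoff-`r` strategy, for `1 ≤ r ≤ n`. -/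
theorem bwSuccess_prob {n : ℕ} (hn : 2 ≤ n) {r : ℕ} (hr : 1 ≤ r) (hrn : r ≤ n) :
    (#{σ | bwSuccess n r σ} : ℚ) / (n.factorial : ℚ) =
      2 * (r : ℚ) * (n - r) / (n * (n - 1)) := by
  have hn0 : (n : ℚ) ≠ 0 := by positivity
  have hn1 : (n : ℚ) - 1 ≠ 0 := by
    have : (2 : ℚ) ≤ n := by exact_mod_cast hn
    linarith
  have hf : (n.factorial : ℚ) ≠ 0 := by positivity
  induction hrn using Nat.decreasingInduction with
  | self =>
    have hempty : #{σ | bwSuccess n n σ} = 0 := by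
      rw [Finset.card_eq_zero, Finset.filter_eq_empty_iff]
      rintro σ - ⟨j, hj, -⟩
      omega
    simp [hempty]
  | of_succ r hrn ih =>
    have hstep := card_bwSuccess_add (⟨r, hrn⟩ : Fin n)
    have hrec := card_bwSuccess_and_bwRecord (⟨r, hrn⟩ : Fin n) hr
    have hext := card_extreme hn (⟨r, hrn⟩ : Fin n)
    have ih := ih (by omega)
    simp only at hstep hrec
    generalize #{σ : Perm (Fin n) | (σ ⟨r, hrn⟩ : ℕ) = 0 ∨ (σ ⟨r, hrn⟩ : ℕ) = n - 1} = e
      at hstep hext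
    generalize #{σ | bwSuccess n (r + 1) σ ∧ bwRecord σ ⟨r, hrn⟩} = x at hstep hrec
    generalize #{σ | bwSuccess n (r + 1) σ} = s at hstep hrec ih
    generalize #{σ | bwSuccess n r σ} = t at hstep ⊢
    have hstep : (t : ℚ) + x = e + s := by exact_mod_cast hstep
    have hrec : ((r : ℚ) + 1) * x = 2 * s := by exact_mod_cast hrec
    have hext : (n : ℚ) * e = 2 * n.factorial := by exact_mod_cast hext
    have hr1 : (r : ℚ) + 1 ≠ 0 := by positivity
    push_cast at ih
    rw [div_eq_iff hf] at ih ⊢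
    have hx : (x : ℚ) = 2 * s / (r + 1) := by rw [eq_div_iff hr1]; linarith
    have he : (e : ℚ) = 2 * n.factorial / n := by rw [eq_div_iff hn0]; linarith
    have ht : (t : ℚ) = e + s - x := by linarith
    rw [ht, hx, he, ih]
    field_simp
    ring

theorem bwSuccess_zero_prob {n : ℕ} (hn : 2 ≤ n) :
    (#{σ | bwSuccess n 0 σ} : ℚ) / (n.factorial : ℚ) = 2 / n := by
  have hset : #{σ | bwSuccess n 0 σ} =
      #{σ : Perm (Fin n) | (σ ⟨0, by omega⟩ : ℕ) = 0 ∨ (σ ⟨0, by omega⟩ : ℕ) = n - 1} := by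
    congr 1
    ext σ
    have h0 : bwRecord σ ⟨0, by omega⟩ := Or.inl fun i hi => by
      rw [show i = ⟨0, by omega⟩ from Fin.ext (Nat.le_zero.mp hi)]
    have h := bwSuccess_iff_s4 σ ⟨0, by omega⟩
    simp only [h0, not_true_eq_false, and_false, or_false] at h
    simp only [Finset.mem_filter, Finset.mem_univ, true_and, h]
  have hext := card_extreme hn (⟨0, by omega⟩ : Fin n)
  rw [← hset] at hext
  rw [div_eq_div_iff (by positivity) (by positivity)]
  exact_mod_cast (mul_comm _ _).trans hext

/-- For `n ≥ 2` and a uniformly random permutation of `{1,…,n}`,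
the threshold strategy with cutoff `⌊n/2⌋` maximizes, over all cutoffs
`r ∈ {0,…,n}`, the success probability in the Best-or-Worst problem, and its
success probability equals `n/(2(n-1))` if `n` is even and `(n+1)/(2n)` if `n`
is odd. -/
theorem stmt_4 (n : ℕ) (hn : 2 ≤ n) :
    (∀ r ≤ n,
      ((Finset.univ.filter (bwSuccess n r)).card : ℚ) / (Nat.factorial n : ℚ) ≤
        ((Finset.univ.filter (bwSuccess n (n / 2))).card : ℚ) / (Nat.factorial n : ℚ)) ∧
    ((Finset.univ.filter (bwSuccess n (n / 2))).card : ℚ) / (Nat.factorial n : ℚ)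
      = if Even n then (n : ℚ) / (2 * ((n : ℚ) - 1)) else ((n : ℚ) + 1) / (2 * (n : ℚ)) := by
  have hn2 : (2 : ℚ) ≤ n := by exact_mod_cast hn
  have hhalf := bwSuccess_prob hn (r := n / 2) (by omega) (by omega)
  have hpos : (0 : ℚ) < n * (n - 1) := by nlinarith
  have hmax : ∀ r : ℕ, r * ((n : ℚ) - r) ≤ (n / 2 : ℕ) * ((n : ℚ) - (n / 2 : ℕ)) := by
    intro r
    obtain ⟨m, hm | hm⟩ := Nat.even_or_odd' n
    · rw [show n / 2 = m by omega, hm]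
      push_cast
      nlinarith [sq_nonneg ((r : ℚ) - m)]
    · rw [show n / 2 = m by omega, hm]
      push_cast
      have hint : (0 : ℤ) ≤ ((r : ℤ) - m) * (r - m - 1) := by
        rcases le_or_gt (r : ℤ) m with h | h
        · exact mul_nonneg_of_nonpos_of_nonpos (by omega) (by omega)
        · exact mul_nonneg (by omega) (by omega)
      have hrat : (0 : ℚ) ≤ ((r : ℚ) - m) * (r - m - 1) := by exact_mod_cast hint
      nlinarith
  refine ⟨fun r hr => ?_, ?_⟩
  · rw [hhalf]
    rcases Nat.eq_zero_or_pos r with rfl | hr0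
    · rw [bwSuccess_zero_prob hn, div_le_div_iff₀ (by linarith) hpos]
      have h := hmax 1
      push_cast at h
      nlinarith
    · rw [bwSuccess_prob hn hr0 hr, div_le_div_iff_of_pos_right hpos]
      linarith [hmax r]
  · rw [hhalf]
    have hn1 : (n : ℚ) - 1 ≠ 0 := by linarith
    have hn0 : (n : ℚ) ≠ 0 := by linarith
    split_ifs with h
    · have hm : ((n / 2 : ℕ) : ℚ) = n / 2 := by
        rw [Nat.cast_div h.two_dvd (by norm_num)]
        norm_num
      rw [hm]
      field_simp
      ring
    · have hm : ((n / 2 : ℕ) : ℚ) = (n - 1) / 2 := by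
        obtain ⟨m, hm⟩ := Nat.not_even_iff_odd.mp h
        rw [show n / 2 = m by omega, hm]
        push_cast
        ring
      rw [hm]
      field_simp
      ring
end

section
/- Fix a real λ > 0. For a positive integer r define P_A(r) := ( Σ_{k=r}^{∞} (r/k)·λ^k/(e^λ·k!) ) / Ψ(r,λ) and P_R(r) := ( Σ_{k=r+1}^{∞} (2r(k−r)/(k(k−1)))·λ^k/(e^λ·k!) ) / Ψ(r,λ), where Ψ(r,λ) := Σ_{k=r}^{∞} λ^k/(e^λ·k!). If P_A(r) > P_R(r), then P_A(r+1) > P_R(r+1). -/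
/-- `Ψ(r,λ) = ∑_{k=r}^∞ λ^k/(e^λ·k!)`, the probability that a Poisson(λ) random
variable is at least `r`. -/
noncomputable def Psi (r : ℕ) (lam : ℝ) : ℝ :=
  ∑' k : ℕ, if r ≤ k then lam ^ k / (Real.exp lam * (Nat.factorial k : ℝ)) else 0

/-- `P_A(r) = (∑_{k=r}^∞ (r/k)·λ^k/(e^λ·k!)) / Ψ(r,λ)`: probability of success when
accepting a nice candidate at step `r` in the Best-or-Worst problem with a
Poisson(λ) number of objects. -/
noncomputable def PA (r : ℕ) (lam : ℝ) : ℝ :=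
  (∑' k : ℕ, if r ≤ k then (r : ℝ) / (k : ℝ) * lam ^ k / (Real.exp lam * (Nat.factorial k : ℝ)) else 0) /
    Psi r lam

/-- `P_R(r) = (∑_{k=r+1}^∞ (2r(k-r)/(k(k-1)))·λ^k/(e^λ·k!)) / Ψ(r,λ)`: probability of
success when rejecting at step `r` and accepting the next nice candidate. -/
noncomputable def PR (r : ℕ) (lam : ℝ) : ℝ :=
  (∑' k : ℕ, if r + 1 ≤ k then
      2 * (r : ℝ) * ((k : ℝ) - (r : ℝ)) / ((k : ℝ) * ((k : ℝ) - 1)) * lam ^ k /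
        (Real.exp lam * (Nat.factorial k : ℝ)) else 0) / Psi r lam

/-- The `k`-th Poisson weight. -/
noncomputable def poissonWeight (lam : ℝ) (k : ℕ) : ℝ :=
  lam ^ k / (Real.exp lam * (Nat.factorial k : ℝ))

/-- The `k`-th term of the series in the numerator of `PA r lam`. -/
noncomputable def acceptTerm (lam : ℝ) (r k : ℕ) : ℝ :=
  if r ≤ k then (r : ℝ) / (k : ℝ) * lam ^ k / (Real.exp lam * (Nat.factorial k : ℝ)) else 0

/-- The `k`-th term of the series in the numerator of `PR r lam`. -/
noncomputable def rejectTerm (lam : ℝ) (r k : ℕ) : ℝ :=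
  if r + 1 ≤ k then
    2 * (r : ℝ) * ((k : ℝ) - (r : ℝ)) / ((k : ℝ) * ((k : ℝ) - 1)) * lam ^ k /
      (Real.exp lam * (Nat.factorial k : ℝ)) else 0

lemma poissonWeight_pos {lam : ℝ} (hlam : 0 < lam) (k : ℕ) : 0 < poissonWeight lam k := by
  unfold poissonWeight
  positivity

lemma poissonWeight_succ (lam : ℝ) (k : ℕ) :
    poissonWeight lam (k + 1) = poissonWeight lam k * (lam / (k + 1)) := by
  unfold poissonWeight
  rw [Nat.factorial_succ]
  push_cast
  field_simp
  ring

lemma summable_poissonWeight (lam : ℝ) : Summable (poissonWeight lam) := by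
  refine ((Real.summable_pow_div_factorial lam).mul_left (Real.exp lam)⁻¹).congr fun k => ?_
  unfold poissonWeight
  field_simp

lemma Psi_pos {lam : ℝ} (hlam : 0 < lam) (r : ℕ) : 0 < Psi r lam := by
  have hnonneg : ∀ k, 0 ≤ if r ≤ k then poissonWeight lam k else 0 := fun k => by
    split_ifs
    exacts [(poissonWeight_pos hlam k).le, le_rfl]
  have hsum : Summable fun k => if r ≤ k then poissonWeight lam k else 0 := by
    refine (summable_poissonWeight lam).of_nonneg_of_le hnonneg fun k => ?_
    split_ifs
    exacts [le_rfl, (poissonWeight_pos hlam k).le]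
  exact hsum.tsum_pos hnonneg r (by simpa using poissonWeight_pos hlam r)

lemma summable_acceptTerm {lam : ℝ} (hlam : 0 < lam) (r : ℕ) :
    Summable (acceptTerm lam r) := by
  refine (summable_poissonWeight lam).of_nonneg_of_le (fun k => ?_) fun k => ?_
  · unfold acceptTerm
    split_ifs <;> positivity
  · have hp := poissonWeight_pos hlam k
    unfold acceptTerm
    split_ifs with hk
    · have hle : (r : ℝ) / k ≤ 1 := div_le_one_of_le₀ (by exact_mod_cast hk) (by positivity)
      rw [mul_div_assoc]
      exact mul_le_of_le_one_left hp.le hle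
    · exact hp.le

lemma summable_rejectTerm {lam : ℝ} (hlam : 0 < lam) {r : ℕ} (hr : 1 ≤ r) :
    Summable (rejectTerm lam r) := by
  have hr' : (1 : ℝ) ≤ r := by exact_mod_cast hr
  refine ((summable_poissonWeight lam).mul_left (2 * (r : ℝ))).of_nonneg_of_le
    (fun k => ?_) fun k => ?_
  · unfold rejectTerm
    split_ifs with hk
    · have hk' : (r : ℝ) + 1 ≤ k := by exact_mod_cast hk
      have h1 : (0 : ℝ) ≤ k - r := by linarith
      have h2 : (0 : ℝ) ≤ k - 1 := by linarith
      positivity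
    · exact le_rfl
  · have hp := poissonWeight_pos hlam k
    unfold rejectTerm
    split_ifs with hk
    · have hk' : (r : ℝ) + 1 ≤ k := by exact_mod_cast hk
      rw [mul_div_assoc]
      refine mul_le_mul_of_nonneg_right ?_ hp.le
      rw [div_le_iff₀ (by nlinarith), mul_assoc, mul_assoc]
      gcongr
      nlinarith
    · positivity

lemma acceptTerm_sub_rejectTerm (lam : ℝ) {r k : ℕ} (hrk : r ≤ k) (hk : 2 ≤ k) :
    acceptTerm lam r k - rejectTerm lam r k =
      r * (2 * r - 1 - k) / (k * (k - 1)) * poissonWeight lam k := by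
  have hk' : (2 : ℝ) ≤ k := by exact_mod_cast hk
  have h0 : (k : ℝ) ≠ 0 := by linarith
  have h1 : (k : ℝ) - 1 ≠ 0 := by linarith
  unfold acceptTerm rejectTerm poissonWeight
  rw [if_pos hrk]
  split_ifs with h
  · field_simp
    ring
  · obtain rfl : r = k := by omega
    field_simp
    ring

lemma acceptTerm_sub_rejectTerm_of_lt (lam : ℝ) {r k : ℕ} (hk : k < r) :
    acceptTerm lam r k - rejectTerm lam r k = 0 := by
  unfold acceptTerm rejectTerm
  rw [if_neg (by omega), if_neg (by omega), sub_zero]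

lemma acceptTerm_sub_rejectTerm_one_one (lam : ℝ) :
    acceptTerm lam 1 1 - rejectTerm lam 1 1 = poissonWeight lam 1 := by
  simp [acceptTerm, rejectTerm, poissonWeight]

lemma PA_sub_PR {lam : ℝ} (hlam : 0 < lam) {r : ℕ} (hr : 1 ≤ r) :
    PA r lam - PR r lam =
      (∑' k, (acceptTerm lam r k - rejectTerm lam r k)) / Psi r lam := by
  rw [(summable_acceptTerm hlam r).tsum_sub (summable_rejectTerm hlam hr), sub_div]
  rfl

/-- Passing from `r` to `r + 1` scales the differences of the terms, shifted by one,
by at least a fixed positive factor. -/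
lemma exists_mul_le_acceptTerm_sub_rejectTerm_succ {lam : ℝ} (hlam : 0 < lam) {r : ℕ}
    (hr : 1 ≤ r) : ∃ C : ℝ, 0 < C ∧ ∀ j, C * (acceptTerm lam r j - rejectTerm lam r j) ≤
      acceptTerm lam (r + 1) (j + 1) - rejectTerm lam (r + 1) (j + 1) := by
  rcases hr.eq_or_lt with rfl | hr2
  · refine ⟨lam / 4, by positivity, fun j => ?_⟩
    rcases Nat.lt_or_ge j 1 with hj | hj
    · rw [acceptTerm_sub_rejectTerm_of_lt lam hj,
        acceptTerm_sub_rejectTerm_of_lt lam (by omega), mul_zero]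
    rw [acceptTerm_sub_rejectTerm lam (k := j + 1) (by omega) (by omega), poissonWeight_succ]
    have hp := poissonWeight_pos hlam j
    rcases hj.eq_or_lt with rfl | hj2
    · rw [acceptTerm_sub_rejectTerm_one_one]
      push_cast
      nlinarith [mul_pos hlam hp]
    · rw [acceptTerm_sub_rejectTerm lam hj hj2]
      have hj' : (2 : ℝ) ≤ j := by exact_mod_cast hj2
      have h1 : (0 : ℝ) < j - 1 := by linarith
      have key : (0 : ℝ) ≤ lam * poissonWeight lam j *
          (((j : ℝ) ^ 2 - 6 * j + 17) / (4 * j * (j + 1) ^ 2)) := by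
        have : (0 : ℝ) ≤ (j : ℝ) ^ 2 - 6 * j + 17 := by nlinarith [sq_nonneg ((j : ℝ) - 3)]
        positivity
      rw [← sub_nonneg]
      convert key using 1
      push_cast
      rw [add_sub_cancel_right]
      field_simp
      ring
  · have hr' : (2 : ℝ) ≤ r := by exact_mod_cast hr2
    have hr1 : (0 : ℝ) < r - 1 := by linarith
    refine ⟨(r - 1) / (2 * r ^ 2) * lam * (r + 1) / r, by positivity, fun j => ?_⟩
    rcases Nat.lt_or_ge j r with hj | hj
    · rw [acceptTerm_sub_rejectTerm_of_lt lam hj,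
        acceptTerm_sub_rejectTerm_of_lt lam (by omega), mul_zero]
    rw [acceptTerm_sub_rejectTerm lam (k := j + 1) (by omega) (by omega), poissonWeight_succ,
      acceptTerm_sub_rejectTerm lam hj (by omega)]
    have hp := poissonWeight_pos hlam j
    have hj' : (r : ℝ) ≤ j := by exact_mod_cast hj
    have h1 : (0 : ℝ) < j - 1 := by linarith
    have h0 : (0 : ℝ) < j := by linarith
    have hpoly : (0 : ℝ) ≤ (2 * r - 1 - j) ^ 2 * ((r - 1) * j - (r + 1)) +
        2 * r ^ 2 * (j - 1) := by
      rcases Nat.lt_or_ge j 3 with hj3 | hj3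
      · obtain rfl : j = 2 := by omega
        obtain rfl : r = 2 := by omega
        norm_num
      · have hj3' : (3 : ℝ) ≤ j := by exact_mod_cast hj3
        have : (0 : ℝ) ≤ (r - 1) * j - (r + 1) := by nlinarith
        positivity
    have key : (0 : ℝ) ≤ lam * poissonWeight lam j * ((r + 1) *
        ((2 * r - 1 - j) ^ 2 * ((r - 1) * j - (r + 1)) + 2 * r ^ 2 * (j - 1)) /
          (2 * r ^ 2 * j * (j - 1) * (j + 1) ^ 2)) := by
      positivity
    rw [← sub_nonneg]
    convert key using 1
    push_cast
    rw [add_sub_cancel_right]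
    field_simp
    ring

/-- For fixed real `λ > 0` and every positive integer `r`:
if `P_A(r) > P_R(r)` then `P_A(r+1) > P_R(r+1)`. -/
theorem stmt_8 (lam : ℝ) (hlam : 0 < lam) (r : ℕ) (hr : 1 ≤ r)
    (h : PA r lam > PR r lam) : PA (r + 1) lam > PR (r + 1) lam := by
  have hsum : ∀ s, 1 ≤ s → Summable fun k => acceptTerm lam s k - rejectTerm lam s k :=
    fun s hs => (summable_acceptTerm hlam s).sub (summable_rejectTerm hlam hs)
  obtain ⟨C, hC, hle⟩ := exists_mul_le_acceptTerm_sub_rejectTerm_succ hlam hr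
  rw [gt_iff_lt, ← sub_pos, PA_sub_PR hlam hr, div_pos_iff_of_pos_right (Psi_pos hlam r)] at h
  have hs := hsum (r + 1) (by omega)
  have hpos : 0 < ∑' k, (acceptTerm lam (r + 1) k - rejectTerm lam (r + 1) k) := by
    rw [hs.tsum_eq_zero_add, acceptTerm_sub_rejectTerm_of_lt lam (by omega), zero_add]
    refine (mul_pos hC h).trans_le ?_
    rw [← tsum_mul_left]
    exact ((hsum r hr).mul_left C).tsum_le_tsum hle
      (hs.comp_injective (add_left_injective 1))
  rw [gt_iff_lt, ← sub_pos, PA_sub_PR hlam (by omega)]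
  exact div_pos hpos (Psi_pos hlam (r + 1))
end

section
/- Define g : (0,1] → ℝ by g(x) := −2x·log x − 2x(1−x), extended continuously by g(0) := 0. There is a unique ϑ ∈ (0,1) satisfying ϑ = e^{2ϑ−2}, one has ϑ = 0.20318786…, and g attains its maximum on [0,1] exactly at x = ϑ, with maximum value g(ϑ) = 2(ϑ − ϑ²) = 0.32380511… . -/
/-- `g(x) = -2x·log x - 2x(1-x)` on `(0,1]`, extended continuously by `g(0) = 0`
(note `Real.log 0 = 0` in Mathlib, so the formula itself gives `g 0 = 0`). -/
noncomputable def g (x : ℝ) : ℝ := -2 * x * Real.log x - 2 * x * (1 - x)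

open Real Set

/-- A quantitative bound for `exp` on `[-1, 1]` from its Taylor polynomial of degree 15. -/
lemma abs_exp_sub_taylor_le {x : ℝ} (hx : |x| ≤ 1) :
    |exp x - ∑ m ∈ Finset.range 16, x ^ m / m.factorial| ≤ 1 / 10 ^ 12 := by
  refine (Real.exp_bound hx (by norm_num)).trans ?_
  calc |x| ^ 16 * (((16 : ℕ).succ : ℝ) / (((16 : ℕ).factorial : ℝ) * (16 : ℕ)))
      ≤ 1 * (((16 : ℕ).succ : ℝ) / (((16 : ℕ).factorial : ℝ) * (16 : ℕ))) := by
        gcongr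
        exact pow_le_one₀ (abs_nonneg x) hx
    _ ≤ 1 / 10 ^ 12 := by norm_num [Nat.factorial]

lemma exp_two_mul_sub_two (a : ℝ) : exp (2 * a - 2) = exp (a - 1) ^ 2 := by
  rw [← Real.exp_nat_mul]
  push_cast
  ring_nf

lemma lt_exp_two_mul_sub_two_left : (0.203187865 : ℝ) < exp (2 * 0.203187865 - 2) := by
  rw [exp_two_mul_sub_two]
  have h := abs_exp_sub_taylor_le (x := 0.203187865 - 1) (by norm_num [abs_le])
  have hlow : (0.45076364813 : ℝ) < exp (0.203187865 - 1) := by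
    have := (abs_le.mp h).1
    norm_num [Finset.sum_range_succ, Nat.factorial] at this ⊢
    linarith
  nlinarith

lemma exp_two_mul_sub_two_right_lt : exp (2 * 0.20318787 - 2) < (0.20318787 : ℝ) := by
  rw [exp_two_mul_sub_two]
  have h := abs_exp_sub_taylor_le (x := 0.20318787 - 1) (by norm_num [abs_le])
  have hup : exp (0.20318787 - 1) < 0.450763652033 := by
    have := (abs_le.mp h).2
    norm_num [Finset.sum_range_succ, Nat.factorial] at this ⊢
    linarith
  nlinarith [exp_pos (0.20318787 - 1)]

lemma exists_eq_exp_two_mul_sub_two :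
    ∃ t ∈ Icc (0.203187865 : ℝ) 0.20318787, t = exp (2 * t - 2) := by
  have hcont : ContinuousOn (fun t : ℝ => t - exp (2 * t - 2))
      (Icc (0.203187865 : ℝ) 0.20318787) := by fun_prop
  obtain ⟨t, ht, h⟩ := intermediate_value_Icc (by norm_num) hcont
    (show (0 : ℝ) ∈ Icc _ _ from
      ⟨sub_nonpos.mpr lt_exp_two_mul_sub_two_left.le,
        sub_nonneg.mpr exp_two_mul_sub_two_right_lt.le⟩)
  exact ⟨t, ht, sub_eq_zero.mp h⟩

lemma log_lt_two_mul_sub_two {t x : ℝ} (ht : log t = 2 * t - 2) (ht1 : t < 1)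
    (hx : 0 < x) (hxt : x < t) : log x < 2 * x - 2 := by
  have h := strictConcaveOn_log_Ioi.slope_anti_adjacent (mem_Ioi.mpr hx)
    (mem_Ioi.mpr one_pos) hxt ht1
  rw [log_one, ht, div_lt_div_iff₀ (sub_pos.mpr ht1) (sub_pos.mpr hxt)] at h
  nlinarith

lemma two_mul_sub_two_lt_log {t x : ℝ} (ht : log t = 2 * t - 2) (ht0 : 0 < t)
    (htx : t < x) (hx : x < 1) : 2 * x - 2 < log x := by
  have h := strictConcaveOn_log_Ioi.slope_anti_adjacent (mem_Ioi.mpr ht0)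
    (mem_Ioi.mpr one_pos) htx hx
  rw [log_one, ht, div_lt_div_iff₀ (sub_pos.mpr hx) (sub_pos.mpr htx)] at h
  nlinarith

lemma continuous_g : Continuous g := by
  have h : g = fun x => -2 * (x * log x) - 2 * x * (1 - x) := by
    funext x
    simp only [g]
    ring
  rw [h]
  exact (continuous_const.mul continuous_mul_log).sub (by fun_prop)

lemma hasDerivAt_g {x : ℝ} (hx : x ≠ 0) :
    HasDerivAt g (-2 * (log x - (2 * x - 2))) x := by
  have h1 := (hasDerivAt_mul_log hx).const_mul (-2)
  have h2 := ((hasDerivAt_id x).const_mul 2).mul ((hasDerivAt_id x).const_sub 1)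
  refine ((h1.sub h2).congr_deriv ?_).congr_of_eventuallyEq (.of_forall fun y => ?_)
  · simp only [id]
    ring
  · simp only [g, Pi.sub_apply, Pi.mul_apply, id]
    ring

lemma strictMonoOn_g {t : ℝ} (ht : log t = 2 * t - 2) (ht1 : t < 1) :
    StrictMonoOn g (Icc 0 t) := by
  refine strictMonoOn_of_deriv_pos (convex_Icc 0 t) continuous_g.continuousOn fun x hx => ?_
  rw [interior_Icc] at hx
  rw [(hasDerivAt_g hx.1.ne').deriv]
  linarith [log_lt_two_mul_sub_two ht ht1 hx.1 hx.2]

lemma strictAntiOn_g {t : ℝ} (ht : log t = 2 * t - 2) (ht0 : 0 < t) :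
    StrictAntiOn g (Icc t 1) := by
  refine strictAntiOn_of_deriv_neg (convex_Icc t 1) continuous_g.continuousOn fun x hx => ?_
  rw [interior_Icc] at hx
  rw [(hasDerivAt_g (ht0.trans hx.1).ne').deriv]
  linarith [two_mul_sub_two_lt_log ht ht0 hx.1 hx.2]

lemma g_lt_of_ne {t x : ℝ} (ht : log t = 2 * t - 2) (ht01 : t ∈ Ioo (0 : ℝ) 1)
    (hx : x ∈ Icc (0 : ℝ) 1) (hne : x ≠ t) : g x < g t := by
  rcases hne.lt_or_gt with h | h
  · exact strictMonoOn_g ht ht01.2 ⟨hx.1, h.le⟩ (right_mem_Icc.mpr ht01.1.le) h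
  · exact strictAntiOn_g ht ht01.1 (left_mem_Icc.mpr ht01.2.le) ⟨h.le, hx.2⟩ h

/-- There is a unique `ϑ ∈ (0,1)` with `ϑ = e^{2ϑ-2}`; it satisfies
`ϑ = 0.20318786…`, and `g` attains its maximum on `[0,1]` exactly at `x = ϑ`, with
maximum value `g(ϑ) = 2(ϑ - ϑ²) = 0.32380511…`. -/
theorem stmt_11 :
    ∃ t : ℝ,
      (t ∈ Set.Ioo (0 : ℝ) 1 ∧ t = Real.exp (2 * t - 2)) ∧
      (∀ t' : ℝ, t' ∈ Set.Ioo (0 : ℝ) 1 ∧ t' = Real.exp (2 * t' - 2) → t' = t) ∧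
      t ∈ Set.Icc (0.20318786 : ℝ) 0.20318787 ∧
      (∀ x ∈ Set.Icc (0 : ℝ) 1, g x ≤ g t) ∧
      (∀ x ∈ Set.Icc (0 : ℝ) 1, g x = g t → x = t) ∧
      g t = 2 * (t - t ^ 2) ∧
      g t ∈ Set.Icc (0.32380511 : ℝ) 0.32380512 := by
  obtain ⟨t, ⟨hlo, hhi⟩, ht⟩ := exists_eq_exp_two_mul_sub_two
  have ht01 : t ∈ Ioo (0 : ℝ) 1 := ⟨by linarith, by linarith⟩
  have hlog_of_eq {s : ℝ} (hs : s = exp (2 * s - 2)) : log s = 2 * s - 2 := by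
    conv_lhs => rw [hs, log_exp]
  have hlog := hlog_of_eq ht
  have hval : g t = 2 * (t - t ^ 2) := by
    rw [g, hlog]
    ring
  refine ⟨t, ⟨ht01, ht⟩, ?_, ⟨by linarith, hhi⟩, ?_, ?_, hval, ?_⟩
  · rintro s ⟨hs01, hs⟩
    have hslog := hlog_of_eq hs
    rcases lt_trichotomy s t with h | h | h
    · exact absurd hslog (log_lt_two_mul_sub_two hlog ht01.2 hs01.1 h).ne
    · exact h
    · exact absurd hslog (two_mul_sub_two_lt_log hlog ht01.1 h hs01.2).ne'
  · intro x hx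
    rcases eq_or_ne x t with rfl | hne
    · exact le_rfl
    · exact (g_lt_of_ne hlog ht01 hx hne).le
  · intro x hx hgx
    by_contra hne
    exact (g_lt_of_ne hlog ht01 hx hne).ne hgx
  · rw [hval]
    constructor <;> nlinarith
end

section
/- Let {F_n} be a sequence of real functions with F_n continuous on [0,n], and let M(n) ∈ [0,n] be a point at which F_n attains its maximum on [0,n]. Define g_n : [0,1] → ℝ by g_n(x) := F_n(n·x), and assume g_n converges uniformly on [0,1] to a function g that has a unique global maximum point θ ∈ [0,1]. Then M(n)/n → θ and F_n(M(n)) → g(θ) as n → ∞; moreover, if 𝔐(n) ∈ [0,n] satisfies 𝔐(n)/M(n) → 1, then F_n(𝔐(n)) → g(θ). -/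
open Filter Topology in
/-- A maximizing sequence on a compact set converges to the unique maximizer. -/
theorem IsCompact.tendsto_of_tendsto_unique_max {ι X : Type*} [TopologicalSpace X]
    {K : Set X} (hK : IsCompact K) {g : X → ℝ} (hg : ContinuousOn g K) {θ : X}
    (huniq : ∀ x ∈ K, g x = g θ → x = θ) {l : Filter ι} {u : ι → X}
    (hu : ∀ i, u i ∈ K) (hlim : Tendsto (fun i => g (u i)) l (𝓝 (g θ))) :
    Tendsto u l (𝓝 θ) := by
  refine hK.tendsto_nhds_of_unique_mapClusterPt (Eventually.of_forall hu) fun z hz hcl => ?_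
  obtain ⟨U, hU, hUz⟩ := mapClusterPt_iff_ultrafilter.1 hcl
  have hgz : Tendsto (fun i => g (u i)) U (𝓝 (g z)) :=
    (hg z hz).tendsto.comp
      (tendsto_nhdsWithin_iff.2 ⟨hUz, Eventually.of_forall hu⟩)
  exact huniq z hz (tendsto_nhds_unique hgz (hlim.mono_left hU))

/-- Lemma 5 of the paper.  Let `F n` be continuous on `[0,n]` and
let `M n ∈ [0,n]` be a point where `F n` attains its maximum on `[0,n]`.  Suppose
`g_n(x) := F n (n·x)` converges uniformly on `[0,1]` to `g`, and `θ ∈ [0,1]` is the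
unique global maximum point of `g` on `[0,1]`.  Then `M n / n → θ`,
`F n (M n) → g θ`, and for any `𝔐 n ∈ [0,n]` with `𝔐 n / M n → 1` also
`F n (𝔐 n) → g θ`. -/
theorem stmt_12 (F : ℕ → ℝ → ℝ) (M : ℕ → ℝ) (g : ℝ → ℝ) (θ : ℝ)
    (hcont : ∀ n : ℕ, ContinuousOn (F n) (Set.Icc 0 (n : ℝ)))
    (hM : ∀ n : ℕ, M n ∈ Set.Icc (0 : ℝ) (n : ℝ))
    (hmax : ∀ n : ℕ, ∀ x ∈ Set.Icc (0 : ℝ) (n : ℝ), F n x ≤ F n (M n))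
    (hunif : TendstoUniformlyOn (fun (n : ℕ) (x : ℝ) => F n ((n : ℝ) * x)) g
      Filter.atTop (Set.Icc 0 1))
    (hθ : θ ∈ Set.Icc (0 : ℝ) 1)
    (hθmax : ∀ x ∈ Set.Icc (0 : ℝ) 1, g x ≤ g θ)
    (hθuniq : ∀ x ∈ Set.Icc (0 : ℝ) 1, g x = g θ → x = θ) :
    Filter.Tendsto (fun n : ℕ => M n / (n : ℝ)) Filter.atTop (nhds θ) ∧
    Filter.Tendsto (fun n : ℕ => F n (M n)) Filter.atTop (nhds (g θ)) ∧
    ∀ Mf : ℕ → ℝ, (∀ n : ℕ, Mf n ∈ Set.Icc (0 : ℝ) (n : ℝ)) →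
      Filter.Tendsto (fun n : ℕ => Mf n / M n) Filter.atTop (nhds 1) →
      Filter.Tendsto (fun n : ℕ => F n (Mf n)) Filter.atTop (nhds (g θ)) := by
  have div_mem : ∀ {n : ℕ} {x : ℝ}, x ∈ Set.Icc (0 : ℝ) n → x / n ∈ Set.Icc (0 : ℝ) 1 :=
    fun {n x} hx => ⟨div_nonneg hx.1 n.cast_nonneg, div_le_one_of_le₀ hx.2 n.cast_nonneg⟩
  have mul_mem : ∀ (n : ℕ) {x : ℝ}, x ∈ Set.Icc (0 : ℝ) 1 → n * x ∈ Set.Icc (0 : ℝ) n :=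
    fun n x hx => ⟨mul_nonneg n.cast_nonneg hx.1,
      mul_le_of_le_one_right n.cast_nonneg hx.2⟩
  have mul_div : ∀ {n : ℕ} {x : ℝ}, x ∈ Set.Icc (0 : ℝ) n → (n : ℝ) * (x / n) = x := by
    intro n x hx
    rcases eq_or_ne (n : ℝ) 0 with hn | hn
    · rw [hn] at hx ⊢
      linarith [hx.1, hx.2]
    · exact mul_div_cancel₀ x hn
  have hg : ContinuousOn g (Set.Icc 0 1) :=
    hunif.continuousOn (Filter.Frequently.of_forall fun n =>
      (hcont n).comp (continuous_const.mul continuous_id).continuousOn fun x hx => mul_mem n hx)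
  -- Evaluating along any points of `[0, n]`, `F n` and the rescaled limit are close.
  have hdiff : ∀ u : ℕ → ℝ, (∀ n : ℕ, u n ∈ Set.Icc (0 : ℝ) n) →
      Filter.Tendsto (fun n : ℕ => F n (u n) - g (u n / n)) Filter.atTop (nhds 0) := by
    intro u hu
    refine Metric.tendsto_nhds.2 fun ε hε => ?_
    filter_upwards [Metric.tendstoUniformlyOn_iff.1 hunif ε hε] with n hn
    have h := hn _ (div_mem (hu n))
    rw [mul_div (hu n), dist_comm, Real.dist_eq] at h
    simpa using h
  have hFM : Filter.Tendsto (fun n : ℕ => F n (M n)) Filter.atTop (nhds (g θ)) := by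
    have hupper : Filter.Tendsto (fun n : ℕ => F n (M n) - g (M n / n) + g θ)
        Filter.atTop (nhds (g θ)) := by
      simpa using (hdiff M hM).add_const (g θ)
    refine tendsto_of_tendsto_of_tendsto_of_le_of_le (hunif.tendsto_at hθ) hupper
      (fun n => hmax n _ (mul_mem n hθ)) fun n => ?_
    linarith [hθmax _ (div_mem (hM n))]
  have hMn : Filter.Tendsto (fun n : ℕ => M n / (n : ℝ)) Filter.atTop (nhds θ) :=
    isCompact_Icc.tendsto_of_tendsto_unique_max hg hθuniq (fun n => div_mem (hM n))
      (by simpa using hFM.sub (hdiff M hM))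
  refine ⟨hMn, hFM, fun Mf hMf hratio => ?_⟩
  have hMfn : Filter.Tendsto (fun n : ℕ => Mf n / (n : ℝ)) Filter.atTop (nhds θ) := by
    have h := hratio.mul hMn
    rw [one_mul] at h
    refine h.congr' ?_
    filter_upwards [hratio.eventually_ne one_ne_zero] with n hn
    exact div_mul_div_cancel₀ (fun h0 => hn (by rw [h0, div_zero]))
  have hgMf : Filter.Tendsto (fun n : ℕ => g (Mf n / n)) Filter.atTop (nhds (g θ)) :=
    (hg θ hθ).tendsto.comp
      (tendsto_nhdsWithin_iff.2 ⟨hMfn, Filter.Eventually.of_forall fun n => div_mem (hMf n)⟩)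
  simpa using (hdiff Mf hMf).add hgMf
end

section
/- For real λ > 0 and real r, define f*(r,λ) := Σ_{k=2}^{∞} (2r(k−r)/(k(k−1)))·λ^k/(e^λ·k!). Then lim_{λ→∞} f*(λ/2, λ) = 1/2. -/
/-- `f*(r,λ) = ∑_{k=2}^∞ (2r(k-r)/(k(k-1)))·λ^k/(e^λ·k!)`: the extension to all
`k ≥ 2` of the series giving the success probability of a threshold strategy with
real cutoff `r` in the Best-or-Worst problem with a Poisson(λ) number of objects. -/
noncomputable def fstar (r lam : ℝ) : ℝ :=
  ∑' k : ℕ, if 2 ≤ k then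
    2 * r * ((k : ℝ) - r) / ((k : ℝ) * ((k : ℝ) - 1)) * lam ^ k /
      (Real.exp lam * (Nat.factorial k : ℝ)) else 0

open Filter Topology

/-- The mass at `k` of the Poisson distribution with parameter `lam`. -/
noncomputable def poissonMass (lam : ℝ) (k : ℕ) : ℝ :=
  Real.exp (-lam) * lam ^ k / (Nat.factorial k : ℝ)

lemma poissonMass_nonneg {lam : ℝ} (hl : 0 ≤ lam) (k : ℕ) : 0 ≤ poissonMass lam k := by
  unfold poissonMass
  positivity

lemma poissonMass_succ (lam : ℝ) (k : ℕ) :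
    poissonMass lam (k + 1) = poissonMass lam k * (lam / (k + 1)) := by
  have : (Nat.factorial k : ℝ) ≠ 0 := by positivity
  unfold poissonMass
  rw [Nat.factorial_succ]
  push_cast
  field_simp
  ring

lemma hasSum_poissonMass (lam : ℝ) : HasSum (poissonMass lam) 1 := by
  have h := (NormedSpace.expSeries_div_hasSum_exp (𝔸 := ℝ) lam).mul_left (Real.exp (-lam))
  rw [← Real.exp_eq_exp_ℝ, ← Real.exp_add, neg_add_cancel, Real.exp_zero] at h
  refine h.congr_fun fun k => ?_
  simp only [poissonMass]
  ring

lemma hasSum_poissonMass_add (lam : ℝ) (m : ℕ) :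
    HasSum (fun j => poissonMass lam (j + m)) (1 - ∑ i ∈ Finset.range m, poissonMass lam i) :=
  (hasSum_nat_add_iff' m).mpr (hasSum_poissonMass lam)

lemma tendsto_poissonMass (k : ℕ) : Tendsto (fun lam => poissonMass lam k) atTop (𝓝 0) := by
  have h := (Real.tendsto_pow_mul_exp_neg_atTop_nhds_zero k).div_const (Nat.factorial k : ℝ)
  rw [zero_div] at h
  refine h.congr fun x => ?_
  simp only [poissonMass]
  ring

lemma tendsto_poissonTail (m : ℕ) :
    Tendsto (fun lam => 1 - ∑ i ∈ Finset.range m, poissonMass lam i) atTop (𝓝 1) := by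
  have h := tendsto_finsetSum (Finset.range m) fun i _ => tendsto_poissonMass i
  simpa using h.const_sub 1

lemma poissonTail_le_one {lam : ℝ} (hl : 0 ≤ lam) (m : ℕ) :
    1 - ∑ i ∈ Finset.range m, poissonMass lam i ≤ 1 :=
  sub_le_self _ (Finset.sum_nonneg fun i _ => poissonMass_nonneg hl i)

/-- The rational weight in `fstar (lam / 2) lam`, at index `x = k ≥ 2`, is approximated by the
weights which merely shift the Poisson masses. -/
lemma abs_weight_sub_le {lam x : ℝ} (hl : 0 < lam) (hx : 2 ≤ x) :
    |lam * (x - lam / 2) / (x * (x - 1))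
        - (lam / (x + 1) - lam / (x + 1) * (lam / (x + 2)) / 2)|
      ≤ 8 / lam * (lam / (x + 1) * (lam / (x + 2)))
        + 25 / 2 / lam * (lam / (x + 1) * (lam / (x + 2)) * (lam / (x + 3))) := by
  have h1 : 0 < x - 1 := by linarith
  have h0 : 0 < x := by linarith
  have e : lam * (x - lam / 2) / (x * (x - 1))
        - (lam / (x + 1) - lam / (x + 1) * (lam / (x + 2)) / 2)
      = 2 * lam / ((x + 1) * (x - 1))
        - lam ^ 2 / 2 * ((4 * x + 2) / (x * (x - 1) * ((x + 1) * (x + 2)))) := by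
    field_simp
    ring
  have hA : 2 * lam / ((x + 1) * (x - 1)) ≤ 8 / lam * (lam / (x + 1) * (lam / (x + 2))) := by
    have : 8 / lam * (lam / (x + 1) * (lam / (x + 2))) = 8 * lam / ((x + 1) * (x + 2)) := by
      field_simp
    rw [this, div_le_div_iff₀ (by positivity) (by positivity)]
    have : 0 ≤ lam * (x + 1) * (6 * (x - 2)) :=
      mul_nonneg (by positivity) (by linarith)
    nlinarith
  have hB : lam ^ 2 / 2 * ((4 * x + 2) / (x * (x - 1) * ((x + 1) * (x + 2))))
      ≤ 25 / 2 / lam * (lam / (x + 1) * (lam / (x + 2)) * (lam / (x + 3))) := by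
    have : 25 / 2 / lam * (lam / (x + 1) * (lam / (x + 2)) * (lam / (x + 3)))
        = lam ^ 2 / 2 * (25 / (x + 3) / ((x + 1) * (x + 2))) := by
      field_simp
    rw [this, ← div_div]
    gcongr ?_ * (?_ / _)
    rw [div_le_div_iff₀ (by positivity) (by positivity)]
    nlinarith
  have hA0 : 0 ≤ 2 * lam / ((x + 1) * (x - 1)) := by positivity
  have hB0 : 0 ≤ lam ^ 2 / 2 * ((4 * x + 2) / (x * (x - 1) * ((x + 1) * (x + 2)))) := by
    positivity
  rw [e, abs_le]
  constructor <;> linarith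

lemma abs_fstar_half_sub_le {lam : ℝ} (hl : 0 < lam) :
    |fstar (lam / 2) lam - ((1 - ∑ i ∈ Finset.range 3, poissonMass lam i)
        - (1 - ∑ i ∈ Finset.range 4, poissonMass lam i) / 2)| ≤ (8 + 25 / 2) / lam := by
  set t : ℕ → ℝ := fun k => if 2 ≤ k then
    2 * (lam / 2) * ((k : ℝ) - lam / 2) / ((k : ℝ) * ((k : ℝ) - 1)) * lam ^ k /
      (Real.exp lam * (Nat.factorial k : ℝ)) else 0 with ht
  set g : ℕ → ℝ := fun j => poissonMass lam (j + 3) - poissonMass lam (j + 4) / 2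
  have hg := (hasSum_poissonMass_add lam 3).sub ((hasSum_poissonMass_add lam 4).div_const 2)
  have hb := ((hasSum_poissonMass_add lam 4).mul_left (8 / lam)).add
    ((hasSum_poissonMass_add lam 5).mul_left (25 / 2 / lam))
  have hbound : ∀ j, ‖t (j + 2) - g j‖
      ≤ 8 / lam * poissonMass lam (j + 4) + 25 / 2 / lam * poissonMass lam (j + 5) := by
    intro j
    have hx : (2 : ℝ) ≤ ((j + 2 : ℕ) : ℝ) := by push_cast; linarith [Nat.cast_nonneg (α := ℝ) j]
    have hw := mul_le_mul_of_nonneg_left (abs_weight_sub_le hl hx)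
      (poissonMass_nonneg hl.le (j + 2))
    have e3 := poissonMass_succ lam (j + 2)
    have e4 := poissonMass_succ lam (j + 3)
    have e5 := poissonMass_succ lam (j + 4)
    have c3 : ((j + 3 : ℕ) : ℝ) + 1 = ((j + 2 : ℕ) : ℝ) + 2 := by push_cast; ring
    have c4 : ((j + 4 : ℕ) : ℝ) + 1 = ((j + 2 : ℕ) : ℝ) + 3 := by push_cast; ring
    rw [c3] at e4
    rw [c4] at e5
    have et : t (j + 2) = poissonMass lam (j + 2) * (lam * (((j + 2 : ℕ) : ℝ) - lam / 2) /
        (((j + 2 : ℕ) : ℝ) * (((j + 2 : ℕ) : ℝ) - 1))) := by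
      simp only [ht, poissonMass, Real.exp_neg, if_pos (Nat.le_add_left 2 j)]
      ring
    rw [← abs_of_nonneg (poissonMass_nonneg hl.le (j + 2)), ← abs_mul,
      abs_of_nonneg (poissonMass_nonneg hl.le (j + 2))] at hw
    simp only [g]
    rw [Real.norm_eq_abs, et, e5, e4, e3]
    generalize 8 / lam = a, 25 / 2 / lam = b at hw ⊢
    refine (le_of_eq ?_).trans (hw.trans_eq ?_)
    · congr 1
      ring
    · ring
  have hsum : HasSum (fun j => t (j + 2)) _ :=
    ((Summable.of_norm_bounded hb.summable hbound).hasSum.add hg).congr_fun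
      fun j => (sub_add_cancel (t (j + 2)) (g j)).symm
  have hf : fstar (lam / 2) lam = _ := ((hasSum_nat_add_iff 2).mp hsum).tsum_eq
  have ht0 : ∑ i ∈ Finset.range 2, t i = 0 := by simp [ht, Finset.sum_range_succ]
  rw [hf, ht0, add_zero, add_sub_cancel_right, ← Real.norm_eq_abs]
  refine (tsum_of_norm_bounded hb hbound).trans ?_
  rw [add_div]
  gcongr
  · exact mul_le_of_le_one_right (by positivity) (poissonTail_le_one hl.le 4)
  · exact mul_le_of_le_one_right (by positivity) (poissonTail_le_one hl.le 5)

/-- `lim_{λ→∞} f*(λ/2, λ) = 1/2`. -/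
theorem stmt_16 :
    Filter.Tendsto (fun lam : ℝ => fstar (lam / 2) lam) Filter.atTop (nhds (1 / 2)) := by
  have herr : Tendsto (fun lam : ℝ => fstar (lam / 2) lam
      - ((1 - ∑ i ∈ Finset.range 3, poissonMass lam i)
        - (1 - ∑ i ∈ Finset.range 4, poissonMass lam i) / 2)) atTop (𝓝 0) := by
    refine squeeze_zero_norm' ?_ (tendsto_const_nhds.div_atTop (a := (8 + 25 / 2 : ℝ)) tendsto_id)
    filter_upwards [eventually_gt_atTop 0] with lam hl using abs_fstar_half_sub_le hl
  have hmain := (tendsto_poissonTail 3).sub ((tendsto_poissonTail 4).div_const 2)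
  have h := herr.add hmain
  simp only [sub_add_cancel] at h
  norm_num at h ⊢
  exact h
end

section
/- For real λ > 0, define I(λ) := ∫_0^λ (e^x − 1)/x dx and r_λ := (1 − e^λ + λ + λ·I(λ)) / (2·(1 − e^λ + 2λ + (λ−1)·I(λ))). Then lim_{λ→∞} r_λ/λ = 1/2 and lim_{λ→∞} (r_λ − λ/2) = −1. -/
/-- `I(λ) = ∫_0^λ (e^x - 1)/x dx` (the integrand extends continuously by value `1`
at `x = 0`). -/
noncomputable def I (lam : ℝ) : ℝ := ∫ x in (0 : ℝ)..lam, (Real.exp x - 1) / x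

/-- `r_λ`: the critical point in `r` of `f*(r,λ)`, the real cutoff maximizing the
extended success probability in the Best-or-Worst problem with a Poisson(λ) number
of objects. -/
noncomputable def rcrit (lam : ℝ) : ℝ :=
  (1 - Real.exp lam + lam + lam * I lam) /
    (2 * (1 - Real.exp lam + 2 * lam + (lam - 1) * I lam))

open Filter Topology

/-- The error of the four-term asymptotic expansion of `I`. -/
noncomputable def expansionError (x : ℝ) : ℝ :=
  I x - Real.exp x * (1 / x + 1 / x ^ 2 + 2 / x ^ 3 + 6 / x ^ 4)

lemma continuous_dslope_exp : Continuous (dslope Real.exp 0) :=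
  continuous_iff_continuousAt.2 fun x => by
    rcases eq_or_ne x 0 with rfl | hx
    · exact continuousAt_dslope_same.2 Real.differentiableAt_exp
    · exact (continuousAt_dslope_of_ne hx).2 Real.continuous_exp.continuousAt

lemma dslope_exp_of_ne {x : ℝ} (hx : x ≠ 0) : dslope Real.exp 0 x = (Real.exp x - 1) / x := by
  rw [dslope_of_ne _ hx, slope_def_field, Real.exp_zero, sub_zero]

lemma I_eq_integral_dslope (lam : ℝ) : I lam = ∫ x in (0 : ℝ)..lam, dslope Real.exp 0 x := by
  refine intervalIntegral.integral_congr_ae ?_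
  filter_upwards [MeasureTheory.Measure.ae_ne MeasureTheory.volume (0 : ℝ)] with x hx _
  exact (dslope_exp_of_ne hx).symm

lemma hasDerivAt_I {x : ℝ} (hx : x ≠ 0) : HasDerivAt I ((Real.exp x - 1) / x) x := by
  rw [← dslope_exp_of_ne hx, funext I_eq_integral_dslope]
  exact (continuous_dslope_exp.integral_hasStrictDerivAt 0 x).hasDerivAt

lemma hasDerivAt_exp_div_pow {x : ℝ} (hx : x ≠ 0) (c : ℝ) (n : ℕ) :
    HasDerivAt (fun y => Real.exp y * (c / y ^ n))
      (Real.exp x * (c / x ^ n - n * c / x ^ (n + 1))) x := by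
  have h := (Real.hasDerivAt_exp x).mul
    ((hasDerivAt_const x c).div (hasDerivAt_pow n x) (pow_ne_zero n hx))
  refine h.congr_deriv ?_
  rcases n with _ | n
  · simp
  · simp only [Pi.div_apply, Nat.add_sub_cancel]
    field_simp
    ring

lemma hasDerivAt_expansionError {x : ℝ} (hx : x ≠ 0) :
    HasDerivAt expansionError (24 * Real.exp x / x ^ 5 - 1 / x) x := by
  have h := (hasDerivAt_I hx).sub
    ((((hasDerivAt_exp_div_pow hx 1 1).add (hasDerivAt_exp_div_pow hx 1 2)).add
      (hasDerivAt_exp_div_pow hx 2 3)).add (hasDerivAt_exp_div_pow hx 6 4))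
  refine (h.congr_deriv ?_).congr_of_eventuallyEq (Eventually.of_forall fun y => ?_)
  · push_cast
    field_simp
    ring
  · simp only [expansionError, Pi.sub_apply, Pi.add_apply, pow_one]
    ring

lemma exists_expansionError_lower_bound :
    ∃ C, ∀ x : ℝ, 10 ≤ x → C - x ≤ expansionError x := by
  have hd : ∀ x : ℝ, 10 ≤ x → HasDerivAt (fun y => expansionError y + y)
      (24 * Real.exp x / x ^ 5 - 1 / x + 1) x := fun x hx =>
    (hasDerivAt_expansionError (by linarith)).add (hasDerivAt_id x)
  have hm : MonotoneOn (fun y => expansionError y + y) (Set.Ici 10) := by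
    refine monotoneOn_of_deriv_nonneg (convex_Ici 10)
      (fun x hx => (hd x hx).continuousAt.continuousWithinAt)
      (fun x hx => (hd x (interior_subset hx)).differentiableAt.differentiableWithinAt)
      fun x hx => ?_
    have hx' : (10 : ℝ) ≤ x := interior_subset hx
    rw [(hd x hx').deriv]
    have h1 : 1 / x ≤ 1 := by rw [div_le_one (by linarith)]; linarith
    have h2 : 0 ≤ 24 * Real.exp x / x ^ 5 := by positivity
    linarith
  refine ⟨expansionError 10 + 10, fun x hx => ?_⟩
  have := hm Set.self_mem_Ici hx hx
  simp only at this
  linarith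

lemma exists_expansionError_upper_bound :
    ∃ C, ∀ x : ℝ, 10 ≤ x → expansionError x ≤ C + Real.exp x * (48 / x ^ 5) := by
  have hd : ∀ x : ℝ, 10 ≤ x →
      HasDerivAt (fun y => expansionError y - Real.exp y * (48 / y ^ 5))
        (24 * Real.exp x / x ^ 5 - 1 / x -
          Real.exp x * (48 / x ^ 5 - (5 : ℕ) * 48 / x ^ (5 + 1))) x := fun x hx =>
    (hasDerivAt_expansionError (by linarith)).sub (hasDerivAt_exp_div_pow (by linarith) 48 5)
  have hm : AntitoneOn (fun y => expansionError y - Real.exp y * (48 / y ^ 5)) (Set.Ici 10) := by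
    refine antitoneOn_of_deriv_nonpos (convex_Ici 10)
      (fun x hx => (hd x hx).continuousAt.continuousWithinAt)
      (fun x hx => (hd x (interior_subset hx)).differentiableAt.differentiableWithinAt)
      fun x hx => ?_
    have hx' : (10 : ℝ) ≤ x := interior_subset hx
    have hx0 : 0 < x := by linarith
    rw [(hd x hx').deriv]
    have h : 24 * Real.exp x / x ^ 5 - 1 / x -
        Real.exp x * (48 / x ^ 5 - (5 : ℕ) * 48 / x ^ (5 + 1)) =
        -(1 / x + 24 * Real.exp x * (x - 10) / x ^ 6) := by
      push_cast
      field_simp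
      ring
    have h1 : 0 ≤ x - 10 := by linarith
    rw [h, neg_nonpos]
    positivity
  refine ⟨expansionError 10 - Real.exp 10 * (48 / 10 ^ 5), fun x hx => ?_⟩
  have := hm Set.self_mem_Ici hx hx
  simp only at this
  linarith

lemma tendsto_scaled_expansionError :
    Tendsto (fun x : ℝ => x ^ 4 * Real.exp (-x) * expansionError x) atTop (𝓝 0) := by
  obtain ⟨A, hA⟩ := exists_expansionError_lower_bound
  obtain ⟨B, hB⟩ := exists_expansionError_upper_bound
  have hl : Tendsto (fun x : ℝ => A * (x ^ 4 * Real.exp (-x)) - x ^ 5 * Real.exp (-x))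
      atTop (𝓝 0) := by
    simpa using ((Real.tendsto_pow_mul_exp_neg_atTop_nhds_zero 4).const_mul A).sub
      (Real.tendsto_pow_mul_exp_neg_atTop_nhds_zero 5)
  have hu : Tendsto (fun x : ℝ => B * (x ^ 4 * Real.exp (-x)) + 48 * x⁻¹) atTop (𝓝 0) := by
    simpa using ((Real.tendsto_pow_mul_exp_neg_atTop_nhds_zero 4).const_mul B).add
      (tendsto_inv_atTop_zero.const_mul (48 : ℝ))
  refine tendsto_of_tendsto_of_tendsto_of_le_of_le' hl hu ?_ ?_
  · filter_upwards [eventually_ge_atTop (10 : ℝ)] with x hx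
    calc A * (x ^ 4 * Real.exp (-x)) - x ^ 5 * Real.exp (-x)
        = x ^ 4 * Real.exp (-x) * (A - x) := by ring
      _ ≤ _ := mul_le_mul_of_nonneg_left (hA x hx) (by positivity)
  · filter_upwards [eventually_ge_atTop (10 : ℝ)] with x hx
    have hx0 : 0 < x := by linarith
    calc x ^ 4 * Real.exp (-x) * expansionError x
        ≤ x ^ 4 * Real.exp (-x) * (B + Real.exp x * (48 / x ^ 5)) :=
          mul_le_mul_of_nonneg_left (hB x hx) (by positivity)
      _ = _ := by
          rw [Real.exp_neg]
          field_simp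

/-- The denominator of `2 * rcrit`, normalized by `x ^ 2 * exp (-x)`, tends to `1`. -/
lemma tendsto_scaled_denominator :
    Tendsto (fun x : ℝ => x ^ 2 * Real.exp (-x) *
      (1 - Real.exp x + 2 * x + (x - 1) * I x)) atTop (𝓝 1) := by
  have hu : Tendsto (fun x : ℝ => x⁻¹) atTop (𝓝 0) := tendsto_inv_atTop_zero
  have h := ((((Real.tendsto_pow_mul_exp_neg_atTop_nhds_zero 2).add
    ((Real.tendsto_pow_mul_exp_neg_atTop_nhds_zero 3).const_mul 2)).add
    ((tendsto_const_nhds (x := (1 : ℝ))).add (hu.const_mul 4))).sub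
    ((hu.pow 2).const_mul 6)).add (tendsto_scaled_expansionError.mul (hu.sub (hu.pow 2)))
  norm_num at h
  refine h.congr' ?_
  filter_upwards [eventually_gt_atTop (0 : ℝ)] with x hx
  simp only [expansionError, Real.exp_neg]
  field_simp
  ring

/-- The numerator of `2 * (rcrit x - x / 2)`, normalized by `x ^ 2 * exp (-x)`,
tends to `-2`. -/
lemma tendsto_scaled_numerator :
    Tendsto (fun x : ℝ => x ^ 2 * Real.exp (-x) *
      ((1 - Real.exp x + x + x * I x) - x * (1 - Real.exp x + 2 * x + (x - 1) * I x)))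
      atTop (𝓝 (-2)) := by
  have hu : Tendsto (fun x : ℝ => x⁻¹) atTop (𝓝 0) := tendsto_inv_atTop_zero
  have h := (((Real.tendsto_pow_mul_exp_neg_atTop_nhds_zero 2).sub
    ((Real.tendsto_pow_mul_exp_neg_atTop_nhds_zero 4).const_mul 2)).add
    ((tendsto_const_nhds (x := (-2 : ℝ))).add (hu.const_mul 12))).add
    (tendsto_scaled_expansionError.mul ((hu.const_mul 2).sub_const 1))
  norm_num at h
  refine h.congr' ?_
  filter_upwards [eventually_gt_atTop (0 : ℝ)] with x hx
  simp only [expansionError, Real.exp_neg]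
  field_simp
  ring

lemma tendsto_rcrit_sub_half :
    Tendsto (fun x : ℝ => rcrit x - x / 2) atTop (𝓝 (-1)) := by
  have h := tendsto_scaled_numerator.div (tendsto_scaled_denominator.const_mul 2) (by norm_num)
  norm_num at h
  refine h.congr' ?_
  filter_upwards [tendsto_scaled_denominator.eventually_ne one_ne_zero] with x hD
  have hw : x ^ 2 * Real.exp (-x) ≠ 0 := left_ne_zero_of_mul hD
  have hD' := right_ne_zero_of_mul hD
  rw [rcrit, Pi.div_apply, mul_left_comm (2 : ℝ), mul_div_mul_left _ _ hw]
  generalize 1 - Real.exp x + 2 * x + (x - 1) * I x = D at hD' ⊢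
  field_simp

/-- `lim_{λ→∞} r_λ/λ = 1/2` and `lim_{λ→∞} (r_λ - λ/2) = -1`. -/
theorem stmt_17 :
    Filter.Tendsto (fun lam : ℝ => rcrit lam / lam) Filter.atTop (nhds (1 / 2)) ∧
    Filter.Tendsto (fun lam : ℝ => rcrit lam - lam / 2) Filter.atTop (nhds (-1)) := by
  refine ⟨?_, tendsto_rcrit_sub_half⟩
  have h := (tendsto_rcrit_sub_half.mul tendsto_inv_atTop_zero).add_const (1 / 2)
  rw [mul_zero, zero_add] at h
  refine h.congr' ?_
  filter_upwards [eventually_gt_atTop (0 : ℝ)] with x hx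
  field_simp
  ring
end

section
/- Define P_BW(1) := 1 and, for integers k ≥ 2, P_BW(k) := k/(2(k−1)) if k is even and P_BW(k) := (k+1)/(2k) if k is odd. Then lim_{λ→∞} Σ_{k=1}^{∞} P_BW(k)·λ^k/(e^λ·k!) = 1/2. -/
/-- `P_BW(k)`: the success probability of the optimal strategy in the Best-or-Worst
problem with a known number `k` of objects: `P_BW(1) = 1`, and for `k ≥ 2`,
`P_BW(k) = k/(2(k-1))` if `k` is even and `(k+1)/(2k)` if `k` is odd. -/
noncomputable def PBW (k : ℕ) : ℝ :=
  if k = 1 then 1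
  else if Even k then (k : ℝ) / (2 * ((k : ℝ) - 1)) else ((k : ℝ) + 1) / (2 * (k : ℝ))

/-- The Poisson weights sum to one. -/
theorem hasSum_pow_div_exp_mul_factorial (x : ℝ) :
    HasSum (fun k : ℕ => x ^ k / (Real.exp x * (Nat.factorial k : ℝ))) 1 := by
  have h := (NormedSpace.expSeries_div_hasSum_exp x).div_const (Real.exp x)
  rw [← Real.exp_eq_exp_ℝ, div_self (Real.exp_pos x).ne'] at h
  refine h.congr_fun fun k => ?_
  rw [div_div, mul_comm]

theorem abs_PBW_sub_half_le {k : ℕ} (hk : 1 ≤ k) :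
    |PBW k - 1 / 2| ≤ 3 / 2 / ((k : ℝ) + 1) := by
  unfold PBW
  split_ifs with h1 h2
  · subst h1
    norm_num [abs_le]
  · have hk' : (2 : ℝ) ≤ k := by exact_mod_cast (by omega : 2 ≤ k)
    have hpos : (0 : ℝ) < k - 1 := by linarith
    have h : (k : ℝ) / (2 * ((k : ℝ) - 1)) - 1 / 2 = 1 / (2 * ((k : ℝ) - 1)) := by
      field_simp
      ring
    rw [h, abs_of_pos (by positivity), div_le_div_iff₀ (by positivity) (by positivity)]
    linarith
  · have hk' : (1 : ℝ) ≤ k := by exact_mod_cast hk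
    have h : ((k : ℝ) + 1) / (2 * (k : ℝ)) - 1 / 2 = 1 / (2 * (k : ℝ)) := by
      field_simp
      ring
    rw [h, abs_of_pos (by positivity), div_le_div_iff₀ (by positivity) (by positivity)]
    linarith

/-- If `b k` is within `C / (k + 1)` of `L`, the Poisson mean of `b` is within `C / x` of `L`. -/
theorem abs_tsum_poisson_sub_le {b : ℕ → ℝ} {L C x : ℝ} (hx : 0 < x)
    (hb : ∀ k : ℕ, |b k - L| ≤ C / ((k : ℝ) + 1)) :
    |∑' k : ℕ, b k * (x ^ k / (Real.exp x * (Nat.factorial k : ℝ))) - L| ≤ C / x := by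
  set w : ℕ → ℝ := fun k => x ^ k / (Real.exp x * (Nat.factorial k : ℝ)) with hw
  have hw_sum : HasSum w 1 := hasSum_pow_div_exp_mul_factorial x
  have hw_nonneg : ∀ k, 0 ≤ w k := fun k => by simp only [hw]; positivity
  have hC : 0 ≤ C := by simpa using (abs_nonneg _).trans (hb 0)
  have hshift : HasSum (fun k => w (k + 1)) (1 - w 0) := by
    simpa using (hasSum_nat_add_iff' 1).mpr hw_sum
  have hbound : ∀ k, ‖(b k - L) * w k‖ ≤ C / x * w (k + 1) := fun k => by
    have heq : C / x * w (k + 1) = C / ((k : ℝ) + 1) * w k := by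
      simp only [hw, Nat.factorial_succ, Nat.cast_mul, Nat.cast_succ, pow_succ]
      field_simp
    rw [heq, norm_mul, Real.norm_eq_abs, Real.norm_of_nonneg (hw_nonneg k)]
    exact mul_le_mul_of_nonneg_right (hb k) (hw_nonneg k)
  have hmaj := hshift.mul_left (C / x)
  have hdiff : Summable fun k => (b k - L) * w k := hmaj.summable.of_norm_bounded hbound
  have hsplit : HasSum (fun k => b k * w k) (∑' k, (b k - L) * w k + L * 1) :=
    (hdiff.hasSum.add (hw_sum.mul_left L)).congr_fun fun k => by ring
  rw [hsplit.tsum_eq, mul_one, add_sub_cancel_right, ← Real.norm_eq_abs]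
  calc ‖∑' k, (b k - L) * w k‖ ≤ C / x * (1 - w 0) := tsum_of_norm_bounded hmaj hbound
    _ ≤ C / x := mul_le_of_le_one_right (by positivity) (by linarith [hw_nonneg 0])

/-- `lim_{λ→∞} ∑_{k=1}^∞ P_BW(k)·λ^k/(e^λ·k!) = 1/2`. -/
theorem stmt_18 :
    Filter.Tendsto
      (fun lam : ℝ =>
        ∑' k : ℕ, if 1 ≤ k then PBW k * lam ^ k / (Real.exp lam * (Nat.factorial k : ℝ)) else 0)
      Filter.atTop (nhds (1 / 2)) := by
  rw [tendsto_iff_norm_sub_tendsto_zero]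
  have hlim : Filter.Tendsto (fun x : ℝ => 3 / 2 / x) Filter.atTop (nhds 0) :=
    tendsto_const_nhds.div_atTop Filter.tendsto_id
  refine squeeze_zero' (.of_forall fun _ => norm_nonneg _) ?_ hlim
  filter_upwards [Filter.eventually_gt_atTop 0] with x hx
  have hb : ∀ k : ℕ, |(if 1 ≤ k then PBW k else 0) - 1 / 2| ≤ 3 / 2 / ((k : ℝ) + 1) := fun k => by
    split_ifs with hk
    · exact abs_PBW_sub_half_le hk
    · obtain rfl : k = 0 := by omega
      norm_num [abs_le]
  simpa only [ite_mul, zero_mul, mul_div_assoc, Real.norm_eq_abs] using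
    abs_tsum_poisson_sub_le hx hb
end

section
/- For real λ > 0 and integers r ≥ 1, define F(r,λ) := Σ_{k=r+1}^{∞} (2r(k−r)/(k(k−1)))·λ^k/(e^λ·k!). Then lim_{λ→∞} F(⌊λ/2⌋, λ) = 1/2 and lim_{λ→∞} sup_{r ≥ 1} F(r,λ) = 1/2. -/
/-- `F(r,λ) = ∑_{k=r+1}^∞ (2r(k-r)/(k(k-1)))·λ^k/(e^λ·k!)`: the success probability
of the cutoff-`r` threshold strategy in the Best-or-Worst problem with a Poisson(λ)
number of objects. -/
noncomputable def FP (r : ℕ) (lam : ℝ) : ℝ :=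
  ∑' k : ℕ, if r + 1 ≤ k then
    2 * (r : ℝ) * ((k : ℝ) - (r : ℝ)) / ((k : ℝ) * ((k : ℝ) - 1)) * lam ^ k /
      (Real.exp lam * (Nat.factorial k : ℝ)) else 0

lemma poissonWeight_nonneg {lam : ℝ} (h : 0 ≤ lam) (k : ℕ) : 0 ≤ poissonWeight lam k := by
  unfold poissonWeight
  positivity

lemma succ_mul_poissonWeight_succ (lam : ℝ) (k : ℕ) :
    ((k : ℝ) + 1) * poissonWeight lam (k + 1) = lam * poissonWeight lam k := by
  unfold poissonWeight
  have h1 : ((Nat.factorial k : ℕ) : ℝ) ≠ 0 := by positivity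
  have h2 : (k : ℝ) + 1 ≠ 0 := by positivity
  rw [Nat.factorial_succ]
  push_cast
  field_simp
  ring

lemma hasSum_poissonWeight (lam : ℝ) : HasSum (poissonWeight lam) 1 := by
  have h : HasSum (fun k : ℕ => lam ^ k / (Nat.factorial k : ℝ)) (Real.exp lam) := by
    rw [Real.exp_eq_exp_ℝ]
    exact NormedSpace.expSeries_div_hasSum_exp lam
  have h2 := h.div_const (Real.exp lam)
  rw [div_self (Real.exp_ne_zero _)] at h2
  refine h2.congr_fun fun k => ?_
  rw [poissonWeight, div_div, mul_comm]

lemma hasSum_poissonWeight_mean (lam : ℝ) :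
    HasSum (fun k : ℕ => (k : ℝ) * poissonWeight lam k) lam := by
  rw [← hasSum_nat_add_iff' 1]
  have h := (hasSum_poissonWeight lam).mul_left lam
  simpa [succ_mul_poissonWeight_succ] using h

lemma hasSum_poissonWeight_second_moment (lam : ℝ) :
    HasSum (fun k : ℕ => (k : ℝ) ^ 2 * poissonWeight lam k) (lam ^ 2 + lam) := by
  rw [← hasSum_nat_add_iff' 1]
  have h := ((hasSum_poissonWeight_mean lam).add (hasSum_poissonWeight lam)).mul_left lam
  have hv : lam ^ 2 + lam - ∑ k ∈ Finset.range 1, (k : ℝ) ^ 2 * poissonWeight lam k =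
      lam * (lam + 1) := by
    simp
    ring
  rw [hv]
  refine h.congr_fun fun k => ?_
  push_cast
  linear_combination ((k : ℝ) + 1) * succ_mul_poissonWeight_succ lam k

lemma hasSum_poissonWeight_sq_sub (lam c : ℝ) :
    HasSum (fun k : ℕ => ((k : ℝ) - c) ^ 2 * poissonWeight lam k) (lam + (lam - c) ^ 2) := by
  have h := ((hasSum_poissonWeight_second_moment lam).sub
    ((hasSum_poissonWeight_mean lam).mul_left (2 * c))).add
    ((hasSum_poissonWeight lam).mul_left (c ^ 2))
  rw [show lam + (lam - c) ^ 2 = lam ^ 2 + lam - 2 * c * lam + c ^ 2 * 1 by ring]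
  exact h.congr_fun fun k => by ring

/-- The general term of the series defining `FP`. -/
noncomputable def successTerm (r : ℕ) (lam : ℝ) (k : ℕ) : ℝ :=
  if r + 1 ≤ k then
    2 * (r : ℝ) * ((k : ℝ) - (r : ℝ)) / ((k : ℝ) * ((k : ℝ) - 1)) * lam ^ k /
      (Real.exp lam * (Nat.factorial k : ℝ)) else 0

lemma successTerm_nonneg {lam : ℝ} (h : 0 ≤ lam) (r k : ℕ) : 0 ≤ successTerm r lam k := by
  unfold successTerm
  split_ifs with hk
  · have h1 : (r : ℝ) + 1 ≤ k := by exact_mod_cast hk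
    have h0 : (0 : ℝ) ≤ r := r.cast_nonneg
    have h2 : (0 : ℝ) ≤ k - r := by linarith
    have h3 : (0 : ℝ) ≤ k - 1 := by linarith
    positivity
  · exact le_rfl

lemma successTerm_le {lam : ℝ} (h : 0 < lam) {r : ℕ} (hr : 1 ≤ r) (k : ℕ) :
    successTerm r lam k ≤
      1 / 2 * poissonWeight lam k + 3 / (2 * lam) * poissonWeight lam (k + 1) := by
  have hw := poissonWeight_nonneg h.le k
  have hw' := poissonWeight_nonneg h.le (k + 1)
  unfold successTerm
  split_ifs with hk
  · have h1 : (r : ℝ) + 1 ≤ k := by exact_mod_cast hk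
    have h0 : (1 : ℝ) ≤ r := by exact_mod_cast hr
    have hs : poissonWeight lam (k + 1) = lam * poissonWeight lam k / (k + 1) := by
      rw [eq_div_iff (by positivity), ← succ_mul_poissonWeight_succ]
      ring
    rw [hs, mul_div_assoc, ← poissonWeight]
    have key : 2 * (r : ℝ) * ((k : ℝ) - (r : ℝ)) / ((k : ℝ) * ((k : ℝ) - 1)) ≤
        1 / 2 + 3 / (2 * ((k : ℝ) + 1)) := by
      have h3 : (0 : ℝ) < k - 1 := by linarith
      have h4 : (0 : ℝ) < k := by linarith
      calc 2 * (r : ℝ) * ((k : ℝ) - (r : ℝ)) / ((k : ℝ) * ((k : ℝ) - 1))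
          ≤ (k ^ 2 / 2) / ((k : ℝ) * ((k : ℝ) - 1)) := by
            gcongr
            nlinarith [sq_nonneg ((k : ℝ) - 2 * r)]
        _ = k / (2 * ((k : ℝ) - 1)) := by field_simp
        _ ≤ ((k : ℝ) + 4) / (2 * (k + 1)) := by
            rw [div_le_div_iff₀ (by positivity) (by positivity)]
            nlinarith
        _ = 1 / 2 + 3 / (2 * ((k : ℝ) + 1)) := by
            field_simp
            ring
    calc _ ≤ (1 / 2 + 3 / (2 * ((k : ℝ) + 1))) * poissonWeight lam k :=
          mul_le_mul_of_nonneg_right key hw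
      _ = _ := by
          field_simp
  · positivity

lemma le_successTerm {lam : ℝ} (h : 0 < lam) {r : ℕ} (hr : 1 ≤ r) (k : ℕ) :
    1 / 2 * poissonWeight lam k -
      3 / lam ^ 2 * ((((k + 2 : ℕ) : ℝ) - (2 * r + 2)) ^ 2 * poissonWeight lam (k + 2)) ≤
      successTerm r lam k := by
  have hw := poissonWeight_nonneg h.le k
  have h0 : (1 : ℝ) ≤ r := by exact_mod_cast hr
  have hs : poissonWeight lam (k + 2) =
      lam ^ 2 * poissonWeight lam k / ((k + 1) * (k + 2)) := by
    have h2 := succ_mul_poissonWeight_succ lam (k + 1)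
    have h1 := succ_mul_poissonWeight_succ lam k
    push_cast at h2
    rw [eq_div_iff (by positivity)]
    linear_combination ((k : ℝ) + 1) * h2 + lam * h1
  have hl : 1 / 2 * poissonWeight lam k -
      3 / lam ^ 2 * ((((k + 2 : ℕ) : ℝ) - (2 * r + 2)) ^ 2 * poissonWeight lam (k + 2)) =
      (1 / 2 - 3 * ((k : ℝ) - 2 * r) ^ 2 / ((k + 1) * (k + 2))) * poissonWeight lam k := by
    rw [hs]
    push_cast
    field_simp
    ring
  rw [hl]
  unfold successTerm
  split_ifs with hk
  · rw [mul_div_assoc _ (lam ^ k), ← poissonWeight]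
    refine mul_le_mul_of_nonneg_right ?_ hw
    have h1 : (r : ℝ) + 1 ≤ k := by exact_mod_cast hk
    have h3 : (0 : ℝ) < k - 1 := by linarith
    have h4 : (0 : ℝ) < k := by linarith
    have h5 : (0 : ℝ) < k - r := by linarith
    calc 1 / 2 - 3 * ((k : ℝ) - 2 * r) ^ 2 / ((k + 1) * (k + 2))
        ≤ 1 / 2 - ((k : ℝ) - 2 * r) ^ 2 / (2 * k ^ 2) := by
          have : ((k : ℝ) - 2 * r) ^ 2 / (2 * k ^ 2) ≤
              3 * ((k : ℝ) - 2 * r) ^ 2 / ((k + 1) * (k + 2)) := by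
            rw [div_le_div_iff₀ (by positivity) (by positivity)]
            have : ((k : ℝ) + 1) * (k + 2) ≤ 6 * k ^ 2 := by nlinarith
            nlinarith [mul_le_mul_of_nonneg_left this (sq_nonneg ((k : ℝ) - 2 * r))]
          linarith
      _ = 2 * (r : ℝ) * ((k : ℝ) - r) / (k * k) := by
          field_simp
          ring
      _ ≤ 2 * (r : ℝ) * ((k : ℝ) - r) / (k * (k - 1)) := by
          gcongr
          linarith
  · refine mul_nonpos_of_nonpos_of_nonneg ?_ hw
    have h1 : (k : ℝ) ≤ r := by exact_mod_cast (by omega : k ≤ r)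
    have h4 : (0 : ℝ) ≤ k := k.cast_nonneg
    have : 1 / 2 ≤ 3 * ((k : ℝ) - 2 * r) ^ 2 / ((k + 1) * (k + 2)) := by
      rw [div_le_div_iff₀ (by positivity) (by positivity)]
      have hrr : (r : ℝ) ^ 2 ≤ ((k : ℝ) - 2 * r) ^ 2 := by nlinarith
      nlinarith
    linarith

lemma hasSum_successTerm_upper (lam : ℝ) :
    HasSum (fun k => 1 / 2 * poissonWeight lam k + 3 / (2 * lam) * poissonWeight lam (k + 1))
      (1 / 2 * 1 + 3 / (2 * lam) * (1 - poissonWeight lam 0)) := by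
  have h := (hasSum_nat_add_iff' 1).mpr (hasSum_poissonWeight lam)
  rw [Finset.sum_range_one] at h
  exact ((hasSum_poissonWeight lam).mul_left _).add (h.mul_left _)

lemma summable_successTerm {lam : ℝ} (h : 0 < lam) {r : ℕ} (hr : 1 ≤ r) :
    Summable (successTerm r lam) :=
  (hasSum_successTerm_upper lam).summable.of_nonneg_of_le
    (successTerm_nonneg h.le r) (successTerm_le h hr)

lemma FP_le {lam : ℝ} (h : 0 < lam) {r : ℕ} (hr : 1 ≤ r) :
    FP r lam ≤ 1 / 2 + 3 / (2 * lam) := by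
  have h1 := hasSum_le (successTerm_le h hr) (summable_successTerm h hr).hasSum
    (hasSum_successTerm_upper lam)
  have h2 : 0 ≤ 3 / (2 * lam) * poissonWeight lam 0 :=
    mul_nonneg (by positivity) (poissonWeight_nonneg h.le 0)
  change ∑' k, successTerm r lam k ≤ _
  linarith

lemma le_FP {lam : ℝ} (h : 0 < lam) {r : ℕ} (hr : 1 ≤ r) :
    1 / 2 - 3 / lam ^ 2 * (lam + (lam - (2 * r + 2)) ^ 2) ≤ FP r lam := by
  have hv := (hasSum_nat_add_iff' 2).mpr (hasSum_poissonWeight_sq_sub lam (2 * r + 2))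
  have h1 := hasSum_le (le_successTerm h hr) (((hasSum_poissonWeight lam).mul_left (1 / 2)).sub
    (hv.mul_left (3 / lam ^ 2))) (summable_successTerm h hr).hasSum
  have h2 : 0 ≤ 3 / lam ^ 2 * ∑ k ∈ Finset.range 2,
      ((k : ℝ) - (2 * r + 2)) ^ 2 * poissonWeight lam k :=
    mul_nonneg (by positivity) (Finset.sum_nonneg fun k _ =>
      mul_nonneg (sq_nonneg _) (poissonWeight_nonneg h.le k))
  change _ ≤ ∑' k, successTerm r lam k
  linarith

lemma le_FP_floor {lam : ℝ} (h : 2 ≤ lam) :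
    1 / 2 - 9 / lam ≤ FP (Nat.floor (lam / 2)) lam := by
  have hr : 1 ≤ Nat.floor (lam / 2) := Nat.le_floor (by push_cast; linarith)
  refine le_trans ?_ (le_FP (by linarith) hr)
  have h1 := Nat.floor_le (by linarith : 0 ≤ lam / 2)
  have h2 := Nat.lt_floor_add_one (lam / 2)
  have h3 : (lam - (2 * (Nat.floor (lam / 2) : ℝ) + 2)) ^ 2 ≤ 4 := by nlinarith
  have h4 : 3 / lam ^ 2 * (lam + (lam - (2 * (Nat.floor (lam / 2) : ℝ) + 2)) ^ 2) ≤
      3 / lam ^ 2 * (3 * lam) := by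
    gcongr
    linarith
  have h5 : 3 / lam ^ 2 * (3 * lam) = 9 / lam := by
    field_simp
    norm_num
  linarith

/-- `lim_{λ→∞} F(⌊λ/2⌋, λ) = 1/2`, and the optimal threshold
success probability `sup_{r ≥ 1} F(r,λ)` also tends to `1/2` as `λ → ∞`
(the supremum over `r ≥ 1` is written as a supremum of `F(r+1,λ)` over `r : ℕ`). -/
theorem stmt_19 :
    Filter.Tendsto (fun lam : ℝ => FP (Nat.floor (lam / 2)) lam) Filter.atTop
      (nhds (1 / 2)) ∧
    Filter.Tendsto (fun lam : ℝ => ⨆ r : ℕ, FP (r + 1) lam) Filter.atTop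
      (nhds (1 / 2)) := by
  have hlow : Filter.Tendsto (fun lam : ℝ => 1 / 2 - 9 / lam) Filter.atTop (nhds (1 / 2)) := by
    simpa using (Filter.tendsto_id.const_div_atTop (9 : ℝ)).const_sub (2⁻¹ : ℝ)
  have hup : Filter.Tendsto (fun lam : ℝ => 1 / 2 + 3 / (2 * lam)) Filter.atTop
      (nhds (1 / 2)) := by
    simpa using ((Filter.tendsto_id.const_mul_atTop (two_pos : (0 : ℝ) < 2)).const_div_atTop
      (3 : ℝ)).const_add (2⁻¹ : ℝ)
  have hfloor : ∀ {lam : ℝ}, 2 ≤ lam → 1 ≤ Nat.floor (lam / 2) := fun h =>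
    Nat.le_floor (by push_cast; linarith)
  constructor
  · refine tendsto_of_tendsto_of_tendsto_of_le_of_le' hlow hup ?_ ?_
    · filter_upwards [Filter.eventually_ge_atTop 2] with lam h using le_FP_floor h
    · filter_upwards [Filter.eventually_ge_atTop 2] with lam h
      exact FP_le (by linarith) (hfloor h)
  · refine tendsto_of_tendsto_of_tendsto_of_le_of_le' hlow hup ?_ ?_
    · filter_upwards [Filter.eventually_ge_atTop 2] with lam h
      have hb : BddAbove (Set.range fun r : ℕ => FP (r + 1) lam) :=
        ⟨1 / 2 + 3 / (2 * lam), by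
          rintro _ ⟨r, rfl⟩
          exact FP_le (by linarith) (Nat.le_add_left 1 r)⟩
      have h1 := le_ciSup hb (Nat.floor (lam / 2) - 1)
      rw [Nat.sub_add_cancel (hfloor h)] at h1
      exact (le_FP_floor h).trans h1
    · filter_upwards [Filter.eventually_ge_atTop 2] with lam h
      exact ciSup_le fun r => FP_le (by linarith) (Nat.le_add_left 1 r)
end
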